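/- arXiv:2307.06021 — 4 statements merged into one kernel-verified Lean document; each statement's English description precedes it below -/
import Mathlib

section
/- Let G be a finite simple graph on {1,…,ℓ}. If G contains an induced cycle of length m (for some m ≥ 3), then the projective dimension of the S-module D(A(G)) is at least m − 3. -/
open MvPolynomial CategoryTheory

/-- The polynomial ring `S = ℚ[x_1, …, x_ℓ]` (variables indexed by `Fin ℓ`). -/
abbrev Spoly (ℓ : ℕ) : Type := MvPolynomial (Fin ℓ) ℚ

/-- The module `D(A(G))` of logarithmic derivations of the graphic arrangement of a
graph `G` on the vertex set `{1, …, ℓ}`: all `θ ∈ Der_ℚ(S)` such that `(x_i - x_j)`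
divides `θ(x_i) - θ(x_j)` for every edge `{i, j}` of `G`. -/
noncomputable def logDer (ℓ : ℕ) (G : SimpleGraph (Fin ℓ)) :
    Submodule (Spoly ℓ) (Derivation ℚ (Spoly ℓ) (Spoly ℓ)) where
  carrier := {θ | ∀ i j : Fin ℓ, G.Adj i j → (X i - X j) ∣ θ (X i) - θ (X j)}
  add_mem' := by
    intro a b ha hb i j h
    have : (a + b) (X i) - (a + b) (X j)
        = (a (X i) - a (X j)) + (b (X i) - b (X j)) := by
      simp only [Derivation.add_apply]; ring
    rw [this]
    exact dvd_add (ha i j h) (hb i j h)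
  zero_mem' := by intro i j h; simp
  smul_mem' := by
    intro c θ hθ i j h
    have : (c • θ) (X i) - (c • θ) (X j) = c * (θ (X i) - θ (X j)) := by
      simp only [Derivation.smul_apply, smul_eq_mul]; ring
    rw [this]
    exact (hθ i j h).mul_left c

/-- `pdLE M n` : `M` admits a projective resolution vanishing in homological
degrees above `n`, i.e. the projective dimension of `M` is at most `n`. -/
def pdLE {R : Type} [CommRing R] (M : ModuleCat R) (n : ℕ) : Prop :=
  ∃ P : ProjectiveResolution M, ∀ i : ℕ, n < i → Limits.IsZero (P.complex.X i)

/-- The projective dimension of a module, as an element of `ℕ∞`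
(infimum of the lengths of projective resolutions; `⊤` if there is none of finite length). -/
noncomputable def pd {R : Type} [CommRing R] (M : ModuleCat R) : ℕ∞ :=
  sInf {n : ℕ∞ | ∃ k : ℕ, (k : ℕ∞) = n ∧ pdLE M k}

/-- `G` contains an induced cycle of length `n`, i.e. an induced subgraph
isomorphic to the cycle graph on `n` vertices. -/
def HasInducedCycleLen {V : Type} (G : SimpleGraph V) (n : ℕ) : Prop :=
  ∃ s : Set V, Nonempty (G.induce s ≃g SimpleGraph.cycleGraph n)

/-- A graph is chordal if it has no induced cycle of length at least 4. -/
def Chordal {V : Type} (G : SimpleGraph V) : Prop :=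
  ∀ n : ℕ, 4 ≤ n → ¬ HasInducedCycleLen G n

/-- A graph is weakly chordal if neither it nor its complement contains an
induced cycle of length at least 5. -/
def WeaklyChordal {V : Type} (G : SimpleGraph V) : Prop :=
  (∀ n : ℕ, 5 ≤ n → ¬ HasInducedCycleLen G n) ∧
  (∀ n : ℕ, 5 ≤ n → ¬ HasInducedCycleLen Gᶜ n)

section ProjectiveDimension

/-- A projective resolution of length `n` bounds the projective dimension by `n`. -/
theorem pdLE.hasProjectiveDimensionLE {R : Type} [CommRing R] {M : ModuleCat R} {n : ℕ}
    (h : pdLE M n) : HasProjectiveDimensionLE M n := by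
  obtain ⟨P, hP⟩ := h
  refine HasProjectiveDimensionLT.mk fun i hi Y e ↦ ?_
  obtain ⟨f, hf, rfl⟩ := P.extMk_surjective e (i + 1) rfl
  obtain rfl : f = 0 := (hP i (by lia)).eq_of_src _ _
  simp

/-- The localization of `M` at `T` has projective dimension `< n`. -/
def LocalizedPdLT {R : Type} [CommRing R] (T : Submonoid R) (M : Type) [AddCommGroup M]
    [Module R M] (n : ℕ) : Prop :=
  HasProjectiveDimensionLT ((ModuleCat.of R M).localizedModule T) n

namespace LocalizedPdLT

variable {R : Type} [CommRing R] {T : Submonoid R} {M N L : Type} [AddCommGroup M]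
  [AddCommGroup N] [AddCommGroup L] [Module R M] [Module R N] [Module R L]

theorem of_hasProjectiveDimensionLE {n : ℕ} (h : HasProjectiveDimensionLE (ModuleCat.of R M) n) :
    LocalizedPdLT T M (n + 1) :=
  ModuleCat.localizedModule_hasProjectiveDimensionLE n T _

theorem of_projective [Module.Projective R M] : LocalizedPdLT T M 1 := by
  have : Projective (ModuleCat.of R M) := ModuleCat.projective_of_categoryTheory_projective _
  exact of_hasProjectiveDimensionLE (n := 0) inferInstance

theorem mono {n m : ℕ} (h : LocalizedPdLT T M n) (hnm : n ≤ m) : LocalizedPdLT T M m :=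
  @hasProjectiveDimensionLT_of_ge _ _ _ _ n m hnm h

theorem shortExact_map {f : M →ₗ[R] N} {g : N →ₗ[R] L} (hfg : Function.Exact f g)
    (hf : Function.Injective f) (hg : Function.Surjective g) :
    ((ModuleCat.shortComplexOfCompEqZero f g hfg.linearMap_comp_eq_zero).map
      (ModuleCat.localizedModuleFunctor T)).ShortExact :=
  (ModuleCat.shortComplex_shortExact
    (ModuleCat.shortComplexOfCompEqZero f g hfg.linearMap_comp_eq_zero) hfg hf hg).map_of_exact _

theorem middle {f : M →ₗ[R] N} {g : N →ₗ[R] L} (hfg : Function.Exact f g)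
    (hf : Function.Injective f) (hg : Function.Surjective g) {n : ℕ}
    (h₁ : LocalizedPdLT T M n) (h₃ : LocalizedPdLT T L n) : LocalizedPdLT T N n :=
  (shortExact_map hfg hf hg).hasProjectiveDimensionLT_X₂ n h₁ h₃

theorem right {f : M →ₗ[R] N} {g : N →ₗ[R] L} (hfg : Function.Exact f g)
    (hf : Function.Injective f) (hg : Function.Surjective g) {n : ℕ}
    (h₁ : LocalizedPdLT T M n) (h₂ : LocalizedPdLT T N (n + 1)) : LocalizedPdLT T L (n + 1) :=
  (shortExact_map hfg hf hg).hasProjectiveDimensionLT_X₃ n h₁ h₂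

theorem zero_of_smul_eq_zero {r : R} (hr : r ∈ T) (h : ∀ x : M, r • x = 0) :
    LocalizedPdLT T M 0 := by
  have : Subsingleton (LocalizedModule T M) :=
    LocalizedModule.subsingleton_iff.mpr fun x ↦ ⟨r, hr, h x⟩
  refine (ModuleCat.isZero_iff_subsingleton.mpr ?_).hasProjectiveDimensionLT_zero
  exact (equivShrink (LocalizedModule T M)).symm.subsingleton

/-- If an injective map has cokernel killed by an element of `T`, then a bound for the source
localized at `T` is a bound for the target. -/
theorem of_smul_mem_range {f : M →ₗ[R] N} (hf : Function.Injective f) {r : R} (hr : r ∈ T)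
    (h : ∀ x : N, r • x ∈ LinearMap.range f) {n : ℕ} (hM : LocalizedPdLT T M n) :
    LocalizedPdLT T N n := by
  refine middle (g := (LinearMap.range f).mkQ) (LinearMap.exact_map_mkQ_range f) hf
    (Submodule.mkQ_surjective _) hM ((zero_of_smul_eq_zero hr fun x ↦ ?_).mono n.zero_le)
  obtain ⟨y, rfl⟩ := Submodule.mkQ_surjective _ x
  rw [← map_smul, Submodule.mkQ_apply, Submodule.Quotient.mk_eq_zero]
  exact h y

end LocalizedPdLT

/-- The quotient by a weakly regular sequence generating a prime ideal `P` has, after localizing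
at `P`, projective dimension at least the length of the sequence. -/
theorem length_lt_of_localizedPdLT {R : Type} [CommRing R] [IsNoetherianRing R] (P : Ideal R)
    [P.IsPrime] {rs : List R} (hrs : RingTheory.Sequence.IsWeaklyRegular R rs)
    (hP : Ideal.ofList rs = P) {n : ℕ} (h : LocalizedPdLT P.primeCompl (R ⧸ P) n) :
    rs.length < n := by
  let A := Localization P.primeCompl
  have : IsLocalRing A := inferInstanceAs (IsLocalRing (Localization.AtPrime P))
  have : IsNoetherianRing A := IsLocalization.isNoetherianRing P.primeCompl A inferInstance
  have hA := hrs.of_isLocalization A P.primeCompl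
  have hmem : ∀ a ∈ rs.map (algebraMap R A), a ∈ IsLocalRing.maximalIdeal A := by
    intro a ha
    obtain ⟨r, hr, rfl⟩ := List.mem_map.mp ha
    refine (IsLocalization.AtPrime.to_map_mem_maximal_iff A P r inferInstance).mpr ?_
    exact hP ▸ Ideal.subset_span hr
  have hpd := ModuleCat.projectiveDimension_quotient_eq_add_length_of_isWeaklyRegular
    (ModuleCat.of A A) _ hA hmem
  rw [ModuleCat.projectiveDimension_eq_zero_of_projective (ModuleCat.of A A), zero_add,
    List.length_map] at hpd
  have hI : (Ideal.ofList (rs.map (algebraMap R A)) • ⊤ : Submodule A A) =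
      Submodule.localized' A P.primeCompl (Algebra.linearMap R A) P := by
    rw [Ideal.localized'_eq_map, ← Ideal.map_ofList, hP, smul_eq_mul, Ideal.mul_top]
  let f : R ⧸ P →ₗ[R] (ModuleCat.of R (R ⧸ P)).localizedModule P.primeCompl :=
    (ModuleCat.of R (R ⧸ P)).localizedModuleMkLinearMap P.primeCompl
  have : IsLocalizedModule P.primeCompl f :=
    ModuleCat.localizedModule_isLocalizedModule (ModuleCat.of R (R ⧸ P)) P.primeCompl
  let e₁ := IsLocalizedModule.linearEquiv P.primeCompl f
    (Submodule.toLocalizedQuotient' A P.primeCompl (Algebra.linearMap R A) P)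
  let e₂ := (LinearEquiv.extendScalarsOfIsLocalization P.primeCompl A e₁).trans
    (Submodule.quotEquivOfEq _ _ hI.symm)
  have := projectiveDimension_eq_of_iso e₂.toModuleIso
  rw [LocalizedPdLT, ← projectiveDimension_lt_iff] at h
  erw [this, hpd] at h
  exact_mod_cast h

end ProjectiveDimension

section CollapsingVariables

open Classical in
/-- The endomorphism of a polynomial ring substituting `X v` for each variable in `T`. -/
noncomputable def collapse {σ K : Type} [CommRing K] (T : Set σ) (v : σ) :
    MvPolynomial σ K →ₐ[K] MvPolynomial σ K :=
  rename fun i ↦ if i ∈ T then v else i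

theorem collapse_X_of_mem {σ K : Type} [CommRing K] {T : Set σ} {v i : σ} (hi : i ∈ T) :
    collapse T v (X i : MvPolynomial σ K) = X v := by
  simp [collapse, hi]

theorem collapse_X_of_notMem {σ K : Type} [CommRing K] {T : Set σ} {v i : σ} (hi : i ∉ T) :
    collapse T v (X i : MvPolynomial σ K) = X i := by
  simp [collapse, hi]

theorem ker_collapse {σ K : Type} [CommRing K] (T : Set σ) {v : σ} (hv : v ∉ T) :
    RingHom.ker (collapse (K := K) T v) = Ideal.span ((fun t ↦ X t - X v) '' T) := by
  set I : Ideal (MvPolynomial σ K) := Ideal.span ((fun t ↦ X t - X v) '' T) with hI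
  apply le_antisymm
  · intro f hf
    have hcomp : (Ideal.Quotient.mkₐ K I).comp (collapse T v) = Ideal.Quotient.mkₐ K I := by
      refine algHom_ext fun i ↦ ?_
      by_cases hi : i ∈ T
      · rw [AlgHom.comp_apply, collapse_X_of_mem hi, Ideal.Quotient.mkₐ_eq_mk, eq_comm,
          Ideal.Quotient.eq]
        exact Ideal.subset_span ⟨i, hi, rfl⟩
      · rw [AlgHom.comp_apply, collapse_X_of_notMem hi]
    have := DFunLike.congr_fun hcomp f
    rw [AlgHom.comp_apply, (RingHom.mem_ker).mp hf, map_zero] at this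
    exact Ideal.Quotient.eq_zero_iff_mem.mp this.symm
  · rw [hI, Ideal.span_le]
    rintro _ ⟨t, ht, rfl⟩
    simp [RingHom.mem_ker, collapse_X_of_mem ht, collapse_X_of_notMem hv]

/-- The differences `X (c j) - X (c 0)` for `j ≠ 0`. -/
noncomputable def baseDifferences {σ : Type} (K : Type) [CommRing K] {n : ℕ}
    (c : Fin (n + 1) → σ) : List (MvPolynomial σ K) :=
  List.ofFn fun j : Fin n ↦ X (c j.succ) - X (c 0)

theorem isWeaklyRegular_baseDifferences {σ K : Type} [CommRing K] [IsDomain K] {n : ℕ}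
    {c : Fin (n + 1) → σ} (hc : Function.Injective c) :
    RingTheory.Sequence.IsWeaklyRegular (MvPolynomial σ K) (baseDifferences K c) := by
  refine ⟨fun i hi ↦ ?_⟩
  have hin : i < n := by simpa [baseDifferences] using hi
  set T : Set σ := {t | ∃ j : Fin n, (j : ℕ) < i ∧ c j.succ = t}
  have h0 : c 0 ∉ T := by
    rintro ⟨j, -, hj⟩
    exact Fin.succ_ne_zero j (hc hj)
  have hiT : c (Fin.succ ⟨i, hin⟩) ∉ T := by
    rintro ⟨j, hj, hji⟩
    have := Fin.succ_injective _ (hc hji)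
    simp [this] at hj
  have hI : (Ideal.ofList ((baseDifferences K c).take i) • ⊤ :
      Submodule (MvPolynomial σ K) (MvPolynomial σ K)) =
      RingHom.ker (collapse (K := K) T (c 0)) := by
    rw [ker_collapse T h0, smul_eq_mul, Ideal.mul_top, Ideal.ofList]
    congr 1
    ext f
    simp only [Set.mem_ofPred_eq, List.mem_take_iff_getElem, baseDifferences, List.getElem_ofFn,
      List.length_ofFn, Set.mem_image, T]
    constructor
    · rintro ⟨j, hj, rfl⟩
      exact ⟨_, ⟨⟨j, by lia⟩, by simp only; lia, rfl⟩, rfl⟩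
    · rintro ⟨_, ⟨j, hj, rfl⟩, rfl⟩
      exact ⟨j, by lia, rfl⟩
  rw [hI, isSMulRegular_iff_right_eq_zero_of_smul]
  intro x hx
  obtain ⟨g, rfl⟩ := Submodule.Quotient.mk_surjective _ x
  rw [← Submodule.Quotient.mk_smul, Submodule.Quotient.mk_eq_zero, RingHom.mem_ker, smul_eq_mul,
    map_mul] at hx
  rw [Submodule.Quotient.mk_eq_zero, RingHom.mem_ker]
  refine (mul_eq_zero.mp hx).resolve_left ?_
  simp only [baseDifferences, List.getElem_ofFn, map_sub, collapse_X_of_notMem h0,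
    collapse_X_of_notMem hiT, sub_ne_zero]
  exact fun h ↦ Fin.succ_ne_zero _ (hc (X_injective h))

end CollapsingVariables

section CyclicDifferences

variable {R σ : Type} [CommRing R] {n : ℕ}

/-- A family on a cycle with zero sum is a family of consecutive differences. -/
theorem exists_cyclic_sub_eq {M : Type} [AddCommGroup M] (h : Fin (n + 1) → M)
    (hh : ∑ k, h k = 0) : ∃ f : Fin (n + 1) → M, ∀ k, f (k + 1) - f k = h k := by
  let h' : ℕ → M := fun i ↦ if hi : i < n + 1 then h ⟨i, hi⟩ else 0
  have hh' (k : Fin (n + 1)) : h' k = h k := dif_pos k.is_lt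
  refine ⟨fun k ↦ ∑ i ∈ Finset.range k, h' i, fun k ↦ ?_⟩
  have hk : ∑ i ∈ Finset.range (k + 1 : Fin (n + 1)), h' i =
      ∑ i ∈ Finset.range ((k : ℕ) + 1), h' i := by
    rw [Fin.val_add_one]
    split_ifs with hlast
    · simp [hlast, Finset.sum_range, hh', hh]
    · rfl
  simp only [hk, Finset.sum_range_succ, add_sub_cancel_left, hh']

/-- The consecutive differences, along the cycle `c`, of a family `f`, each modulo the
corresponding consecutive difference of the family `a`. -/
noncomputable def cyclicDifferences (a : Fin (n + 1) → R) (c : Fin (n + 1) → σ) :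
    (σ → R) →ₗ[R] (∀ k, R ⧸ Ideal.span {a (k + 1) - a k}) :=
  LinearMap.pi fun k ↦ (Ideal.span {a (k + 1) - a k}).mkQ ∘ₗ
    (LinearMap.proj (R := R) (φ := fun _ : σ ↦ R) (c (k + 1)) -
      LinearMap.proj (R := R) (φ := fun _ : σ ↦ R) (c k))

theorem mem_ker_cyclicDifferences {a : Fin (n + 1) → R} {c : Fin (n + 1) → σ} {f : σ → R} :
    f ∈ LinearMap.ker (cyclicDifferences a c) ↔
      ∀ k, a (k + 1) - a k ∣ f (c (k + 1)) - f (c k) := by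
  rw [LinearMap.mem_ker, funext_iff]
  refine forall_congr' fun k ↦ ?_
  rw [← Ideal.mem_span_singleton]
  exact Submodule.Quotient.mk_eq_zero _

/-- The sum of a family of residues modulo consecutive differences of `a`, modulo an ideal
containing all these differences. -/
noncomputable def cyclicSum (a : Fin (n + 1) → R) (P : Ideal R) (hP : ∀ k, a (k + 1) - a k ∈ P) :
    (∀ k, R ⧸ Ideal.span {a (k + 1) - a k}) →ₗ[R] R ⧸ P :=
  ∑ k, Submodule.factor ((Ideal.span_singleton_le_iff_mem P).mpr (hP k)) ∘ₗ LinearMap.proj k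

theorem cyclicSum_mk {a : Fin (n + 1) → R} {P : Ideal R} (hP : ∀ k, a (k + 1) - a k ∈ P)
    (g : Fin (n + 1) → R) :
    cyclicSum a P hP (fun k ↦ (Ideal.span {a (k + 1) - a k}).mkQ (g k)) = P.mkQ (∑ k, g k) := by
  simp [cyclicSum]

theorem cyclicSum_surjective {a : Fin (n + 1) → R} {P : Ideal R}
    (hP : ∀ k, a (k + 1) - a k ∈ P) : Function.Surjective (cyclicSum a P hP) := by
  intro x
  obtain ⟨r, rfl⟩ := P.mkQ_surjective x
  exact ⟨_, (cyclicSum_mk hP (Pi.single 0 r)).trans (by simp)⟩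

theorem exact_cyclicDifferences_cyclicSum {a : Fin (n + 1) → R} {c : Fin (n + 1) → σ}
    (hc : Function.Injective c) {P : Ideal R} (hP : ∀ k, a (k + 1) - a k ∈ P)
    (hspan : P ≤ Ideal.span (Set.range fun k ↦ a (k + 1) - a k)) :
    Function.Exact (cyclicDifferences a c) (cyclicSum a P hP) := by
  intro x
  constructor
  · intro hx
    choose g hg using fun k ↦ Submodule.mkQ_surjective _ (x k)
    obtain rfl : (fun k ↦ (Ideal.span {a (k + 1) - a k}).mkQ (g k)) = x := _root_.funext hg
    rw [cyclicSum_mk, Submodule.mkQ_apply, Submodule.Quotient.mk_eq_zero] at hx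
    obtain ⟨d, hd⟩ := Ideal.mem_span_range_iff_exists_fun.mp (hspan hx)
    obtain ⟨f, hf⟩ := exists_cyclic_sub_eq (fun k ↦ g k - d k * (a (k + 1) - a k))
      (by rw [Finset.sum_sub_distrib, hd, sub_self])
    refine ⟨Function.extend c f 0, _root_.funext fun k ↦ (Submodule.Quotient.eq _).mpr ?_⟩
    simp only [LinearMap.sub_apply, LinearMap.proj_apply, hc.extend_apply, hf]
    exact Ideal.mem_span_singleton.mpr ⟨-d k, by ring⟩
  · rintro ⟨f, rfl⟩
    refine (cyclicSum_mk hP fun k ↦ f (c (k + 1)) - f (c k)).trans ?_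
    have := Equiv.sum_comp (Equiv.addRight (1 : Fin (n + 1))) (fun k ↦ f (c k))
    simp only [Equiv.coe_addRight] at this
    rw [Finset.sum_sub_distrib, this, sub_self, map_zero]

theorem LocalizedPdLT.pi_quotient_span_singleton {ι : Type} [Finite ι] {T : Submonoid R}
    {b : ι → R} (hb : ∀ k, IsSMulRegular R (b k)) :
    LocalizedPdLT T (∀ k, R ⧸ Ideal.span {b k}) 2 := by
  let f : (ι → R) →ₗ[R] (ι → R) := LinearMap.pi fun k ↦ b k • LinearMap.proj k
  let g : (ι → R) →ₗ[R] (∀ k, R ⧸ Ideal.span {b k}) :=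
    LinearMap.pi fun k ↦ (Ideal.span {b k}).mkQ ∘ₗ LinearMap.proj k
  refine LocalizedPdLT.right (f := f) (g := g) (fun x ↦ ?_) (fun x y hxy ↦ ?_) (fun x ↦ ?_)
    (LocalizedPdLT.of_projective (M := ι → R))
    ((LocalizedPdLT.of_projective (M := ι → R)).mono one_le_two)
  · have : g x = 0 ↔ ∀ k, b k ∣ x k := by
      rw [funext_iff]
      refine forall_congr' fun k ↦ ?_
      rw [← Ideal.mem_span_singleton]
      exact Submodule.Quotient.mk_eq_zero _
    rw [this]
    constructor
    · intro h
      choose d hd using h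
      exact ⟨d, _root_.funext fun k ↦ (hd k).symm⟩
    · rintro ⟨d, rfl⟩ k
      exact ⟨d k, rfl⟩
  · exact _root_.funext fun k ↦ hb k (congrFun hxy k)
  · choose d hd using fun k ↦ Submodule.mkQ_surjective _ (x k)
    exact ⟨d, _root_.funext hd⟩

/-- A bound on the projective dimension of the kernel of `cyclicDifferences`, localized at `T`,
gives a bound for the quotient by the ideal generated by the consecutive differences. -/
theorem LocalizedPdLT.quotient_of_ker_cyclicDifferences [Finite σ] {T : Submonoid R}
    {a : Fin (n + 1) → R} {c : Fin (n + 1) → σ} (hc : Function.Injective c)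
    (ha : ∀ k, IsSMulRegular R (a (k + 1) - a k)) {P : Ideal R}
    (hP : P = Ideal.span (Set.range fun k ↦ a (k + 1) - a k)) {m : ℕ}
    (h : LocalizedPdLT T (LinearMap.ker (cyclicDifferences a c)) (m + 1)) :
    LocalizedPdLT T (R ⧸ P) (m + 3) := by
  have hmem : ∀ k, a (k + 1) - a k ∈ P := fun k ↦ hP ▸ Ideal.subset_span ⟨k, rfl⟩
  have hrange : LocalizedPdLT T (LinearMap.range (cyclicDifferences a c)) (m + 2) :=
    LocalizedPdLT.right (f := (LinearMap.ker (cyclicDifferences a c)).subtype)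
      (g := (cyclicDifferences a c).rangeRestrict)
      (fun x ↦ by simp [Subtype.ext_iff]) (Submodule.injective_subtype _)
      (LinearMap.surjective_rangeRestrict _) h (LocalizedPdLT.of_projective.mono (by lia))
  refine LocalizedPdLT.right (f := (LinearMap.range (cyclicDifferences a c)).subtype)
    (g := cyclicSum a P hmem) (fun x ↦ ?_) (Submodule.injective_subtype _)
    (cyclicSum_surjective hmem) hrange
    ((LocalizedPdLT.pi_quotient_span_singleton ha).mono (by lia))
  rw [exact_cyclicDifferences_cyclicSum hc hmem hP.le x]
  simp

end CyclicDifferences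

/-- Consecutive differences along a cycle generate the same ideal as `baseDifferences`. -/
theorem ofList_baseDifferences {σ K : Type} [CommRing K] {n : ℕ} (c : Fin (n + 1) → σ) :
    Ideal.ofList (baseDifferences K c) =
      Ideal.span (Set.range fun k ↦ (X (c (k + 1)) - X (c k) : MvPolynomial σ K)) := by
  apply le_antisymm
  · rw [Ideal.ofList, Ideal.span_le]
    intro f hf
    obtain ⟨j, rfl⟩ := List.mem_ofFn.mp hf
    generalize j.succ = i
    induction i using Fin.induction with
    | zero => simp
    | succ i ih =>
      rw [← sub_add_sub_cancel _ (X (c i.castSucc))]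
      refine add_mem (Ideal.subset_span ⟨i.castSucc, ?_⟩) ih
      simp only [Fin.coeSucc_eq_succ]
  · rw [Ideal.span_le]
    have h : ∀ i, X (c i) - X (c 0) ∈ Ideal.ofList (baseDifferences K c) := by
      refine Fin.cases (by simp) fun j ↦ Ideal.subset_span ?_
      exact List.mem_ofFn.mpr ⟨j, rfl⟩
    rintro _ ⟨k, rfl⟩
    simpa using sub_mem (h (k + 1)) (h k)

section InducedCycle

variable {ℓ : ℕ} {G : SimpleGraph (Fin ℓ)} {n : ℕ} {c : Fin (n + 3) → Fin ℓ}

/-- A logarithmic derivation, viewed as the family of its values at the variables, which satisfies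
the divisibility conditions along a cycle of the graph. -/
noncomputable def logDerToKer (hc : ∀ k, G.Adj (c (k + 1)) (c k)) :
    logDer ℓ G →ₗ[Spoly ℓ]
      LinearMap.ker (cyclicDifferences (fun k ↦ (X (c k) : Spoly ℓ)) c) where
  toFun θ := ⟨fun i ↦ θ.1 (X i), mem_ker_cyclicDifferences.mpr fun k ↦ θ.2 _ _ (hc k)⟩
  map_add' _ _ := rfl
  map_smul' _ _ := rfl

theorem logDerToKer_injective (hc : ∀ k, G.Adj (c (k + 1)) (c k)) :
    Function.Injective (logDerToKer hc) := fun _ _ h ↦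
  Subtype.ext (derivation_ext fun i ↦ congrFun (congrArg Subtype.val h) i)

open Classical in
/-- The product of the linear forms of all edges which are not contained in the image of `c`. -/
noncomputable def outerProduct (G : SimpleGraph (Fin ℓ)) (c : Fin (n + 3) → Fin ℓ) : Spoly ℓ :=
  ∏ e : Fin ℓ × Fin ℓ with G.Adj e.1 e.2 ∧ ¬ (e.1 ∈ Set.range c ∧ e.2 ∈ Set.range c),
    (X e.1 - X e.2)

theorem outerProduct_notMem {T : Set (Fin ℓ)} (hT : insert (c 0) T = Set.range c) :
    outerProduct G c ∉ RingHom.ker (collapse (K := ℚ) T (c 0)) := by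
  classical
  have hin {i} (hi : i ∈ Set.range c) : collapse T (c 0) (X i : Spoly ℓ) = X (c 0) := by
    by_cases hiT : i ∈ T
    · exact collapse_X_of_mem hiT
    · obtain rfl : i = c 0 := (hT ▸ hi : i ∈ insert (c 0) T).resolve_right hiT
      exact collapse_X_of_notMem hiT
  have hout {i} (hi : i ∉ Set.range c) : collapse T (c 0) (X i : Spoly ℓ) = X i :=
    collapse_X_of_notMem fun hiT ↦ hi (hT ▸ Set.mem_insert_of_mem _ hiT)
  have h0 : c 0 ∈ Set.range c := ⟨0, rfl⟩
  rw [RingHom.mem_ker, outerProduct, map_prod]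
  refine Finset.prod_ne_zero_iff.mpr ?_
  rintro ⟨i, j⟩ he
  obtain ⟨hadj, hij⟩ := (Finset.mem_filter.mp he).2
  rw [map_sub, sub_ne_zero]
  by_cases hi : i ∈ Set.range c <;> by_cases hj : j ∈ Set.range c
  · exact absurd ⟨hi, hj⟩ hij
  · rw [hin hi, hout hj]
    exact fun h ↦ hj (X_injective h ▸ h0)
  · rw [hout hi, hin hj]
    exact fun h ↦ hi (X_injective h ▸ h0)
  · rw [hout hi, hout hj]
    exact fun h ↦ hadj.ne (X_injective h)

theorem outerProduct_smul_mem_range (hc : ∀ j k, G.Adj (c j) (c k) ↔ j = k + 1 ∨ k = j + 1)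
    (f : LinearMap.ker (cyclicDifferences (fun k ↦ (X (c k) : Spoly ℓ)) c)) :
    outerProduct G c • f ∈
      LinearMap.range (logDerToKer fun k ↦ (hc (k + 1) k).mpr (.inl rfl)) := by
  classical
  refine ⟨⟨mkDerivation ℚ (outerProduct G c • f.1), fun i j hij ↦ ?_⟩,
    Subtype.ext (_root_.funext fun i ↦ mkDerivation_X _ _ _)⟩
  have hf := mem_ker_cyclicDifferences.mp f.2
  simp only [mkDerivation_X, Pi.smul_apply, smul_eq_mul, ← mul_sub]
  by_cases hr : i ∈ Set.range c ∧ j ∈ Set.range c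
  · obtain ⟨⟨a, rfl⟩, ⟨b, rfl⟩⟩ := hr
    apply Dvd.dvd.mul_left
    obtain rfl | rfl := (hc _ _).mp hij
    · exact hf b
    · rw [← neg_dvd, ← dvd_neg, neg_sub, neg_sub]
      exact hf a
  · apply Dvd.dvd.mul_right
    exact Finset.dvd_prod_of_mem (fun e : Fin ℓ × Fin ℓ ↦ (X e.1 - X e.2 : Spoly ℓ))
      (a := (i, j)) (by simp only [Finset.mem_filter, Finset.mem_univ, true_and]; exact ⟨hij, hr⟩)

theorem LocalizedPdLT.ker_cyclicDifferences
    (hc : ∀ j k, G.Adj (c j) (c k) ↔ j = k + 1 ∨ k = j + 1) {T : Submonoid (Spoly ℓ)}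
    (hT : outerProduct G c ∈ T) {m : ℕ} (h : LocalizedPdLT T (logDer ℓ G) m) :
    LocalizedPdLT T (LinearMap.ker (cyclicDifferences (fun k ↦ (X (c k) : Spoly ℓ)) c)) m := by
  obtain ⟨f, hf, hr⟩ : ∃ f : logDer ℓ G →ₗ[Spoly ℓ]
      LinearMap.ker (cyclicDifferences (fun k ↦ (X (c k) : Spoly ℓ)) c),
      Function.Injective f ∧ ∀ x, outerProduct G c • x ∈ LinearMap.range f :=
    ⟨logDerToKer fun k ↦ (hc (k + 1) k).mpr (.inl rfl), logDerToKer_injective _,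
      outerProduct_smul_mem_range hc⟩
  exact LocalizedPdLT.of_smul_mem_range hf hT hr h

theorem le_of_pdLE_logDer (hinj : Function.Injective c)
    (hc : ∀ j k, G.Adj (c j) (c k) ↔ j = k + 1 ∨ k = j + 1) {k : ℕ}
    (h : pdLE (ModuleCat.of (Spoly ℓ) (logDer ℓ G)) k) : n ≤ k := by
  set T : Set (Fin ℓ) := Set.range fun j : Fin (n + 2) ↦ c j.succ with hT
  have h0 : c 0 ∉ T := by
    rintro ⟨j, hj⟩
    exact Fin.succ_ne_zero j (hinj hj)
  have hins : insert (c 0) T = Set.range c := by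
    ext i
    simp [hT, Fin.exists_fin_succ, eq_comm]
  obtain ⟨P, hPdef⟩ : ∃ P : Ideal (Spoly ℓ), P = RingHom.ker (collapse (K := ℚ) T (c 0)) :=
    ⟨_, rfl⟩
  have : P.IsPrime := hPdef ▸ RingHom.ker_isPrime _
  have hP : Ideal.ofList (baseDifferences ℚ c) = P := by
    rw [hPdef, ker_collapse T h0, Ideal.ofList]
    congr 1
    ext f
    simp only [baseDifferences, hT, List.mem_ofFn, Set.mem_image, Set.mem_range,
      exists_exists_eq_and, Set.mem_ofPred_eq]
  have hreg (k) : IsSMulRegular (Spoly ℓ) (X (c (k + 1)) - X (c k) : Spoly ℓ) := by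
    refine (IsRegular.of_ne_zero (sub_ne_zero.mpr fun h ↦ ?_)).left.isSMulRegular
    exact ((hc (k + 1) k).mpr (.inl rfl)).ne (X_injective h)
  have hD : LocalizedPdLT P.primeCompl (logDer ℓ G) (k + 1) :=
    LocalizedPdLT.of_hasProjectiveDimensionLE h.hasProjectiveDimensionLE
  have hout : outerProduct G c ∈ P.primeCompl := by
    rw [Ideal.mem_primeCompl_iff, hPdef]
    exact outerProduct_notMem hins
  have hK : LocalizedPdLT P.primeCompl
      (LinearMap.ker (cyclicDifferences (fun k ↦ (X (c k) : Spoly ℓ)) c)) (k + 1) :=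
    hD.ker_cyclicDifferences hc hout
  have hQ : LocalizedPdLT P.primeCompl (Spoly ℓ ⧸ P) (k + 3) :=
    LocalizedPdLT.quotient_of_ker_cyclicDifferences hinj hreg
      (hP.symm.trans (ofList_baseDifferences c)) hK
  have := length_lt_of_localizedPdLT P (isWeaklyRegular_baseDifferences hinj) hP hQ
  simp only [baseDifferences, List.length_ofFn] at this
  lia

end InducedCycle

/-- If `G` contains an induced cycle of length `m ≥ 3`, then the projective
dimension of `D(A(G))` is at least `m - 3`. -/
theorem pd_ge_of_hasInducedCycle (ℓ : ℕ) (hℓ : 1 ≤ ℓ) (G : SimpleGraph (Fin ℓ))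
    (m : ℕ) (hm : 3 ≤ m) (hcyc : HasInducedCycleLen G m) :
    ((m - 3 : ℕ) : ℕ∞) ≤ pd (ModuleCat.of (Spoly ℓ) (logDer ℓ G)) := by
  obtain ⟨n, rfl⟩ := Nat.exists_eq_add_of_le' hm
  obtain ⟨s, ⟨φ⟩⟩ := hcyc
  refine le_sInf ?_
  rintro _ ⟨k, rfl, hk⟩
  rw [Nat.cast_le, Nat.add_sub_cancel]
  refine le_of_pdLE_logDer (c := fun j ↦ (φ.symm j : Fin ℓ))
    (Subtype.val_injective.comp φ.symm.injective) (fun j k ↦ ?_) hk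
  have : G.Adj (φ.symm j) (φ.symm k) ↔ (SimpleGraph.cycleGraph (n + 3)).Adj j k :=
    φ.symm.map_adj_iff
  rw [this, SimpleGraph.cycleGraph_adj, sub_eq_iff_eq_add', sub_eq_iff_eq_add']
end

section
/- Let G be a finite simple graph on {1,…,ℓ}. The S-module D(A(G)) is free if and only if G is chordal. -/
open MvPolynomial CategoryTheory

theorem X_sub_X_ne_zero {V : Type} {i j : V} (h : i ≠ j) : (X i - X j : MvPolynomial V ℚ) ≠ 0 :=
  sub_ne_zero.2 fun e => h (X_injective e)

/-- The substitution that sends the variables in `R` to zero. -/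
noncomputable def killVars {V : Type} (R : Set V) : MvPolynomial V ℚ →ₐ[ℚ] MvPolynomial V ℚ :=
  open Classical in aeval fun i => if i ∈ R then 0 else X i

theorem killVars_of_dvd {V : Type} {R : Set V} {i j : V} (hi : i ∈ R) (hj : j ∈ R) {p : MvPolynomial V ℚ}
    (h : X i - X j ∣ p) : killVars R p = 0 := by
  obtain ⟨q, rfl⟩ := h
  simp [killVars, hi, hj]

theorem exists_dvd_killVars_ne_zero {V : Type} [Fintype V] (G : SimpleGraph V) (R : Set V) :
    ∃ s : MvPolynomial V ℚ, killVars R s ≠ 0 ∧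
      ∀ i j, G.Adj i j → ¬ (i ∈ R ∧ j ∈ R) → X i - X j ∣ s := by
  classical
  refine ⟨∏ e : V × V with G.Adj e.1 e.2 ∧ ¬ (e.1 ∈ R ∧ e.2 ∈ R), (X e.1 - X e.2), ?_,
    fun i j h h' => ?_⟩
  swap
  · have hmem : (i, j) ∈ ({e | G.Adj e.1 e.2 ∧ ¬ (e.1 ∈ R ∧ e.2 ∈ R)} : Finset (V × V)) :=
      Finset.mem_filter.2 ⟨Finset.mem_univ _, h, h'⟩
    rw [← Finset.mul_prod_erase _ _ hmem]
    exact dvd_mul_right _ _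
  rw [map_prod, Finset.prod_ne_zero_iff]
  rintro ⟨i, j⟩ he
  obtain ⟨hij, hr⟩ := (Finset.mem_filter.1 he).2
  dsimp only at hij hr ⊢
  simp only [killVars, map_sub, aeval_X]
  split_ifs with h₁ h₂ h₂
  · exact absurd ⟨h₁, h₂⟩ hr
  · simp
  · simp
  · exact X_sub_X_ne_zero hij.ne

section Poly
variable {V : Type} [DecidableEq V]

/-- The substitution `X i ↦ X j`. -/
noncomputable def identify (i j : V) : MvPolynomial V ℚ →ₐ[ℚ] MvPolynomial V ℚ :=
  aeval fun k => if k = i then X j else X k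

theorem identify_X (i j k : V) :
    identify i j (X k) = if k = i then X j else (X k : MvPolynomial V ℚ) := by
  simp [identify]

theorem X_sub_X_dvd_sub_identify (i j : V) (p : MvPolynomial V ℚ) :
    X i - X j ∣ p - identify i j p := by
  have h : (Ideal.Quotient.mkₐ ℚ (Ideal.span {(X i - X j : MvPolynomial V ℚ)})).comp
      (identify i j) = Ideal.Quotient.mkₐ ℚ _ := by
    ext k
    simp only [AlgHom.comp_apply, identify_X, Ideal.Quotient.mkₐ_eq_mk]
    split_ifs with hk
    · subst hk
      symm
      rw [Ideal.Quotient.mk_eq_mk_iff_sub_mem]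
      exact Ideal.mem_span_singleton_self _
    · rfl
  rw [← Ideal.mem_span_singleton, ← Ideal.Quotient.mk_eq_mk_iff_sub_mem]
  exact (DFunLike.congr_fun h p).symm

theorem X_sub_X_dvd_iff (i j : V) (p : MvPolynomial V ℚ) :
    X i - X j ∣ p ↔ identify i j p = 0 := by
  constructor
  · rintro ⟨q, rfl⟩
    by_cases h : j = i <;> simp [identify_X, h]
  · intro h
    simpa [h] using X_sub_X_dvd_sub_identify i j p

theorem prime_X_sub_X {i j : V} (h : i ≠ j) : Prime (X i - X j : MvPolynomial V ℚ) := by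
  refine ⟨X_sub_X_ne_zero h, fun hu => ?_, fun p q hpq => ?_⟩
  · have := (X_sub_X_dvd_iff i j 1).1 hu.dvd
    simp at this
  · simpa [X_sub_X_dvd_iff] using hpq

theorem X_sub_X_not_dvd {i j k l : V} (hkl : k ≠ l) (h₁ : ¬ (k = i ∧ l = j))
    (h₂ : ¬ (k = j ∧ l = i)) : ¬ (X i - X j : MvPolynomial V ℚ) ∣ X k - X l := by
  rw [X_sub_X_dvd_iff, map_sub, identify_X, identify_X, sub_eq_zero]
  split_ifs <;> intro e <;> have := X_injective e <;> grind

theorem prod_X_sub_X_dvd {v : V} {T : Finset V} (hv : v ∉ T) {p : MvPolynomial V ℚ}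
    (h : ∀ j ∈ T, X v - X j ∣ p) : ∏ j ∈ T, (X v - X j) ∣ p := by
  refine Finset.prod_dvd_of_isRelPrime (fun i hi j hj hij => ?_) h
  have hi' : v ≠ i := fun e => hv (e ▸ hi)
  have hj' : v ≠ j := fun e => hv (e ▸ hj)
  exact (prime_X_sub_X hi').irreducible.isRelPrime_iff_not_dvd.2
    (X_sub_X_not_dvd hj' (fun e => hij e.2.symm) (fun e => hi' e.1))

theorem exists_interpolation (T : Finset V) (f : V → MvPolynomial V ℚ)
    (hf : ∀ i ∈ T, ∀ j ∈ T, i ≠ j → X i - X j ∣ f i - f j) :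
    ∃ P : Polynomial (MvPolynomial V ℚ), ∀ j ∈ T, P.eval (X j) = f j := by
  induction T using Finset.induction_on with
  | empty => exact ⟨0, by simp⟩
  | insert v T hv ih =>
    obtain ⟨P, hP⟩ := ih fun i hi j hj =>
      hf i (Finset.mem_insert_of_mem hi) j (Finset.mem_insert_of_mem hj)
    obtain ⟨c, hc⟩ : ∏ j ∈ T, (X v - X j) ∣ f v - P.eval (X v) := by
      refine prod_X_sub_X_dvd hv fun j hj => ?_
      have h₁ := hf v (Finset.mem_insert_self _ _) j (Finset.mem_insert_of_mem hj)
        fun e => hv (e ▸ hj)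
      have h₂ := Polynomial.sub_dvd_eval_sub (X v) (X j) P
      rw [hP j hj] at h₂
      simpa using dvd_sub h₁ h₂
    refine ⟨P + Polynomial.C c * ∏ j ∈ T, (Polynomial.X - Polynomial.C (X j)), fun j hj => ?_⟩
    rcases Finset.mem_insert.1 hj with rfl | hj
    · simp only [Polynomial.eval_add, Polynomial.eval_mul, Polynomial.eval_C,
        Polynomial.eval_prod, Polynomial.eval_sub, Polynomial.eval_X]
      linear_combination -hc
    · have : ∏ k ∈ T, (X j - X k : MvPolynomial V ℚ) = 0 :=
        Finset.prod_eq_zero hj (sub_self _)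
      simp [Polynomial.eval_prod, hP j hj, this]

/-- Exactness of the Koszul complex of three consecutive differences of variables, in the last
coordinate. -/
theorem koszul_exact {u v w z : V} (huv : u ≠ v) (hvw : v ≠ w) (huw : u ≠ w) (huz : u ≠ z)
    (hvz : v ≠ z) (hwz : w ≠ z) {p q r : MvPolynomial V ℚ}
    (h : (X u - X v) * p + (X v - X w) * q + (X w - X z) * r = 0) :
    ∃ a b : MvPolynomial V ℚ, r = (X u - X v) * b - (X v - X w) * a := by
  have h0 := congrArg (fun t => identify v w (identify u v t)) h
  simp only [map_add, map_mul, map_sub, identify_X, if_true, if_neg huv.symm, if_neg huw.symm,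
    if_neg huz.symm, if_neg hvz.symm, if_neg hvw.symm, sub_self, zero_mul, zero_add, map_zero] at h0
  have h1 := (mul_eq_zero.1 h0).resolve_left (X_sub_X_ne_zero hwz)
  obtain ⟨b, hb⟩ := X_sub_X_dvd_sub_identify u v r
  obtain ⟨a, ha⟩ := (X_sub_X_dvd_iff _ _ _).2 h1
  exact ⟨-a, b, by linear_combination hb + ha⟩

end Poly

section Spline
variable {V : Type}

/-- The functions supported on `W` that satisfy the divisibility conditions imposed by the edges
of `G` inside `W`. -/
noncomputable def splines (G : SimpleGraph V) (W : Finset V) :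
    Submodule (MvPolynomial V ℚ) (V → MvPolynomial V ℚ) where
  carrier := {f | (∀ i ∉ W, f i = 0) ∧ ∀ i ∈ W, ∀ j ∈ W, G.Adj i j → X i - X j ∣ f i - f j}
  add_mem' {f g} hf hg := by
    refine ⟨fun i hi => by simp [hf.1 i hi, hg.1 i hi], fun i hi j hj h => ?_⟩
    have := dvd_add (hf.2 i hi j hj h) (hg.2 i hi j hj h)
    simpa only [Pi.add_apply, add_sub_add_comm] using this
  zero_mem' := by simp
  smul_mem' c f hf := by
    refine ⟨fun i hi => by simp [hf.1 i hi], fun i hi j hj h => ?_⟩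
    simpa only [Pi.smul_apply, smul_eq_mul, mul_sub] using (hf.2 i hi j hj h).mul_left c

/-- A vertex of `W` whose neighbours in `W` are pairwise adjacent. -/
def SimplicialIn (G : SimpleGraph V) (W : Finset V) (w : V) : Prop :=
  w ∈ W ∧ ∀ x ∈ W, ∀ y ∈ W, G.Adj w x → G.Adj w y → x ≠ y → G.Adj x y

variable [DecidableEq V]

/-- Forgetting the value of a spline at `v`. -/
noncomputable def splinesErase (G : SimpleGraph V) (W : Finset V) (v : V) :
    splines G W →ₗ[MvPolynomial V ℚ] splines G (W.erase v) where
  toFun f := ⟨Function.update f.1 v 0, by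
    refine ⟨fun i hi => ?_, fun i hi j hj h => ?_⟩
    · by_cases hv : i = v
      · simp [hv]
      · rw [Function.update_of_ne hv]
        exact f.2.1 i fun hW => hi (Finset.mem_erase.2 ⟨hv, hW⟩)
    · rw [Finset.mem_erase] at hi hj
      rw [Function.update_of_ne hi.1, Function.update_of_ne hj.1]
      exact f.2.2 i hi.2 j hj.2 h⟩
  map_add' f g := by
    ext1; funext i
    by_cases hv : i = v <;> simp [hv]
  map_smul' c f := by
    ext1; funext i
    by_cases hv : i = v <;> simp [hv]

theorem splinesErase_apply (G : SimpleGraph V) (W : Finset V) (v : V) (f : splines G W) :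
    (splinesErase G W v f : V → MvPolynomial V ℚ) = Function.update f.1 v 0 :=
  rfl

theorem splinesErase_surjective {G : SimpleGraph V} {W : Finset V} {v : V}
    (hv : SimplicialIn G W v) : Function.Surjective (splinesErase G W v) := by
  classical
  intro f
  obtain ⟨P, hP⟩ := exists_interpolation (W.filter (G.Adj v)) f.1 (by
    intro i hi j hj hij
    rw [Finset.mem_filter] at hi hj
    exact f.2.2 i (Finset.mem_erase.2 ⟨hi.2.ne', hi.1⟩) j (Finset.mem_erase.2 ⟨hj.2.ne', hj.1⟩)
      (hv.2 i hi.1 j hj.1 hi.2 hj.2 hij))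
  have key : ∀ j ∈ W, G.Adj v j → X v - X j ∣ P.eval (X v) - f.1 j := fun j hj h => by
    rw [← hP j (Finset.mem_filter.2 ⟨hj, h⟩)]
    exact Polynomial.sub_dvd_eval_sub _ _ _
  refine ⟨⟨Function.update f.1 v (P.eval (X v)), fun i hi => ?_, fun i hi j hj h => ?_⟩, ?_⟩
  · rw [Function.update_of_ne (show i ≠ v from fun e => hi (e ▸ hv.1))]
    exact f.2.1 i fun h => hi (Finset.mem_of_mem_erase h)
  · by_cases hiv : i = v
    · subst hiv
      rw [Function.update_self, Function.update_of_ne h.ne']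
      exact key j hj h
    · rw [Function.update_of_ne hiv]
      by_cases hjv : j = v
      · subst hjv
        rw [Function.update_self, ← neg_sub, neg_dvd, dvd_sub_comm]
        exact key i hi h.symm
      · rw [Function.update_of_ne hjv]
        exact f.2.2 i (Finset.mem_erase.2 ⟨hiv, hi⟩) j (Finset.mem_erase.2 ⟨hjv, hj⟩) h
  · ext1
    rw [splinesErase_apply, Function.update_idem, Function.update_eq_self_iff]
    exact (f.2.1 v (Finset.notMem_erase _ _)).symm

open Classical in
/-- The multiples of the product of the linear forms at `v`, as splines supported at `v`. -/
noncomputable def splinesSingle (G : SimpleGraph V) (W : Finset V) (v : V) (hv : v ∈ W) :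
    MvPolynomial V ℚ →ₗ[MvPolynomial V ℚ] splines G W :=
  LinearMap.toSpanSingleton _ _
    ⟨Pi.single v (∏ j ∈ W.filter (G.Adj v), (X v - X j)), by
      have key : ∀ j ∈ W, G.Adj v j →
          X v - X j ∣ ∏ j ∈ W.filter (G.Adj v), (X v - X j : MvPolynomial V ℚ) := fun j hj h =>
        Finset.dvd_prod_of_mem _ (Finset.mem_filter.2 ⟨hj, h⟩)
      refine ⟨fun i hi => Pi.single_eq_of_ne (show i ≠ v from fun e => hi (e ▸ hv)) _, fun i hi j hj h => ?_⟩
      by_cases hiv : i = v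
      · subst hiv
        rw [Pi.single_eq_same, Pi.single_eq_of_ne h.ne', sub_zero]
        exact key j hj h
      · rw [Pi.single_eq_of_ne hiv, zero_sub, dvd_neg]
        by_cases hjv : j = v
        · subst hjv
          rw [Pi.single_eq_same, ← neg_sub, neg_dvd]
          exact key i hi h.symm
        · rw [Pi.single_eq_of_ne hjv]
          exact dvd_zero _⟩

open Classical in
theorem splinesSingle_apply (G : SimpleGraph V) (W : Finset V) (v : V) (hv : v ∈ W)
    (c : MvPolynomial V ℚ) : (splinesSingle G W v hv c : V → MvPolynomial V ℚ) =
      c • Pi.single v (∏ j ∈ W.filter (G.Adj v), (X v - X j)) :=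
  rfl

theorem splinesSingle_injective (G : SimpleGraph V) (W : Finset V) (v : V) (hv : v ∈ W) :
    Function.Injective (splinesSingle G W v hv) := by
  classical
  refine (injective_iff_map_eq_zero _).2 fun c hc => ?_
  have := congrFun (congrArg Subtype.val hc) v
  rw [splinesSingle_apply] at this
  simp only [Pi.smul_apply, Pi.single_eq_same, smul_eq_mul, ZeroMemClass.coe_zero,
    Pi.zero_apply, mul_eq_zero, Finset.prod_eq_zero_iff] at this
  refine this.resolve_right ?_
  rintro ⟨j, hj, h⟩
  exact X_sub_X_ne_zero (Finset.mem_filter.1 hj).2.ne h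

theorem splines_exact (G : SimpleGraph V) (W : Finset V) (v : V) (hv : v ∈ W) :
    Function.Exact (splinesSingle G W v hv) (splinesErase G W v) := by
  classical
  intro f
  constructor
  · intro hf
    have hz : ∀ i ≠ v, f.1 i = 0 := fun i hi => by
      have := congrFun (congrArg Subtype.val hf) i
      rwa [splinesErase_apply, Function.update_of_ne hi] at this
    obtain ⟨c, hc⟩ : ∏ j ∈ W.filter (G.Adj v), (X v - X j) ∣ f.1 v := by
      refine prod_X_sub_X_dvd (by simp) fun j hj => ?_
      rw [Finset.mem_filter] at hj
      simpa [hz j hj.2.ne'] using f.2.2 v hv j hj.1 hj.2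
    refine ⟨c, ?_⟩
    ext1; funext i
    rw [splinesSingle_apply]
    by_cases hi : i = v
    · subst hi
      simp [hc, mul_comm]
    · simp [hi, hz i hi]
  · rintro ⟨c, rfl⟩
    ext1; funext i
    rw [splinesErase_apply, splinesSingle_apply]
    by_cases hi : i = v
    · subst hi; simp
    · simp [hi]

/-- If every nonempty set of vertices contains a simplicial vertex, the splines form a free
module. -/
theorem free_splines (G : SimpleGraph V)
    (hG : ∀ W : Finset V, W.Nonempty → ∃ v, SimplicialIn G W v) (W : Finset V) :
    Module.Free (MvPolynomial V ℚ) (splines G W) := by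
  induction W using Finset.strongInduction with
  | H W ih =>
    rcases W.eq_empty_or_nonempty with rfl | hW
    · have : Subsingleton (splines G ∅) := ⟨fun f g => by
        ext1; funext i
        rw [f.2.1 i (Finset.notMem_empty i), g.2.1 i (Finset.notMem_empty i)]⟩
      infer_instance
    · obtain ⟨v, hv⟩ := hG W hW
      have := ih (W.erase v) (Finset.erase_ssubset hv.1)
      obtain ⟨l, hl⟩ := (splinesErase G W v).exists_rightInverse_of_surjective
        (LinearMap.range_eq_top.2 (splinesErase_surjective hv))
      exact Module.Free.of_equiv ((splines_exact G W v hv.1).splitSurjectiveEquiv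
        (splinesSingle_injective G W v hv.1) ⟨l, hl⟩).1.symm

end Spline

section Graph
variable {V : Type}

theorem cycleGraph_adj_iff_val {n : ℕ} {u v : Fin n} : (SimpleGraph.cycleGraph n).Adj u v ↔
    u ≠ v ∧ (u.val + 1 = v.val ∨ v.val + 1 = u.val ∨ (u.val = 0 ∧ v.val + 1 = n) ∨
      (v.val = 0 ∧ u.val + 1 = n)) := by
  have hu := u.isLt
  have hv := v.isLt
  rw [SimpleGraph.cycleGraph_adj', Ne, Fin.ext_iff]
  rcases lt_trichotomy u v with h | h | h
  · have h₁ := Fin.coe_sub_iff_lt.2 h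
    have h₂ := Fin.coe_sub_iff_le.2 h.le
    rw [Fin.lt_def] at h
    omega
  · subst h
    have h₁ := Fin.coe_sub_iff_le.2 (le_refl u)
    omega
  · have h₁ := Fin.coe_sub_iff_lt.2 h
    have h₂ := Fin.coe_sub_iff_le.2 h.le
    rw [Fin.lt_def] at h
    omega

theorem hasInducedCycleLen_iff {G : SimpleGraph V} {n : ℕ} :
    HasInducedCycleLen G n ↔ Nonempty (SimpleGraph.cycleGraph n ↪g G) :=
  ⟨fun ⟨s, ⟨e⟩⟩ => ⟨e.symm.toEmbedding.trans (SimpleGraph.Embedding.induce s)⟩,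
    fun ⟨f⟩ => ⟨Set.range f, ⟨f.isoInduceRange.symm⟩⟩⟩

/-- The graph on all vertices that keeps only the edges inside `T`. -/
def edgesWithin (G : SimpleGraph V) (T : Set V) : SimpleGraph V where
  Adj x y := G.Adj x y ∧ x ∈ T ∧ y ∈ T
  symm := ⟨fun _ _ h => ⟨h.1.symm, h.2.2, h.2.1⟩⟩
  loopless := ⟨fun _ h => h.1.ne rfl⟩

theorem edgesWithin_mono (G : SimpleGraph V) {T T' : Set V} (h : T ⊆ T') :
    edgesWithin G T ≤ edgesWithin G T' :=
  fun _ _ hxy => ⟨hxy.1, h hxy.2.1, h hxy.2.2⟩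

/-- Two neighbours of `v` that are linked by a path avoiding all other neighbours of `v` are
adjacent. -/
theorem Chordal.adj_of_reachable {G : SimpleGraph V} (hG : Chordal G) {v s t : V}
    (hs : G.Adj v s) (ht : G.Adj v t) (hst : s ≠ t)
    (h : (edgesWithin G ({x | x ≠ v ∧ ¬ G.Adj v x} ∪ {s, t})).Reachable s t) : G.Adj s t := by
  by_contra hadj
  set T : Set V := {x | x ≠ v ∧ ¬ G.Adj v x} ∪ {s, t} with hT
  obtain ⟨p, hp⟩ := h.exists_walk_length_eq_dist
  have hp0 : p.getVert 0 = s := p.getVert_zero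
  have hpk : p.getVert p.length = t := p.getVert_length
  have hmem : ∀ i ≤ p.length, p.getVert i ∈ T := by
    intro i hi
    rcases hi.lt_or_eq with hi | rfl
    · exact (p.adj_getVert_succ hi).2.1
    · rw [hpk]; simp [hT]
  have hne : ∀ i j, i < j → j ≤ p.length → p.getVert i ≠ p.getVert j := by
    intro i j hij hj e
    have := SimpleGraph.dist_le ((p.take i).append ((p.drop j).copy e.symm rfl))
    rw [SimpleGraph.Walk.length_append, SimpleGraph.Walk.length_copy,
      SimpleGraph.Walk.take_length, SimpleGraph.Walk.drop_length] at this
    omega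
  have hchord : ∀ i j, i < j → j ≤ p.length → G.Adj (p.getVert i) (p.getVert j) → j = i + 1 := by
    intro i j hij hj e
    have e' : (edgesWithin G T).Adj (p.getVert i) (p.getVert j) :=
      ⟨e, hmem i (by omega), hmem j hj⟩
    have := SimpleGraph.dist_le ((p.take i).append (SimpleGraph.Walk.cons e' (p.drop j)))
    rw [SimpleGraph.Walk.length_append, SimpleGraph.Walk.length_cons,
      SimpleGraph.Walk.take_length, SimpleGraph.Walk.drop_length] at this
    omega
  have hsucc : ∀ i < p.length, G.Adj (p.getVert i) (p.getVert (i + 1)) := fun i hi =>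
    (p.adj_getVert_succ hi).1
  have hk : 2 ≤ p.length := by
    by_contra! hlt
    obtain hl | hl : p.length = 0 ∨ p.length = 1 := by omega
    · rw [hl, hp0] at hpk
      exact hst hpk
    · have := hsucc 0 (by omega)
      rw [hp0, zero_add, ← hl, hpk] at this
      exact hadj this
  have hv : ∀ i ≤ p.length, v ≠ p.getVert i := by
    intro i hi e
    have := hmem i hi
    rw [← e] at this
    rcases this with h | h | h
    · exact h.1 rfl
    · exact hs.ne h
    · exact ht.ne h
  have hvadj : ∀ i ≤ p.length, (G.Adj v (p.getVert i) ↔ i = 0 ∨ i = p.length) := by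
    intro i hi
    constructor
    · intro h
      by_contra! hcon
      rcases hmem i hi with h' | h' | h'
      · exact h'.2 h
      · exact hne 0 i (by omega) hi (hp0.trans h'.symm)
      · exact hne i p.length (by omega) le_rfl (h'.trans hpk.symm)
    · rintro (rfl | rfl)
      · rwa [hp0]
      · rwa [hpk]
  have hpadj : ∀ i ≤ p.length, ∀ j ≤ p.length,
      (G.Adj (p.getVert i) (p.getVert j) ↔ i + 1 = j ∨ j + 1 = i) := by
    intro i hi j hj
    constructor
    · intro h
      rcases lt_trichotomy i j with hij | hij | hij
      · exact Or.inl (hchord i j hij hj h).symm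
      · exact absurd (congrArg p.getVert hij) h.ne
      · exact Or.inr (hchord j i hij hi h.symm).symm
    · rintro (rfl | rfl)
      · exact hsucc i (by omega)
      · exact (hsucc j (by omega)).symm
  let g : Fin (p.length + 2) → V := fun i => if i.val = p.length + 1 then v else p.getVert i
  have hg : ∀ i, g i = if i.val = p.length + 1 then v else p.getVert i := fun _ => rfl
  have hinj : Function.Injective g := by
    intro i j hij
    have hi := i.isLt
    have hj := j.isLt
    rw [Fin.ext_iff]
    rw [hg, hg] at hij
    split_ifs at hij with h₁ h₂ h₂
    · omega
    · exact absurd hij (hv _ (by omega))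
    · exact absurd hij.symm (hv _ (by omega))
    · by_contra hcon
      rcases Nat.lt_or_gt_of_ne hcon with h | h
      · exact hne _ _ h (by omega) hij
      · exact hne _ _ h (by omega) hij.symm
  have hgadj : ∀ i j, G.Adj (g i) (g j) ↔ (SimpleGraph.cycleGraph (p.length + 2)).Adj i j := by
    intro i j
    have hi := i.isLt
    have hj := j.isLt
    rw [cycleGraph_adj_iff_val, Ne, Fin.ext_iff, hg, hg]
    split_ifs with h₁ h₂ h₂
    · simp only [SimpleGraph.irrefl, false_iff]; omega
    · rw [hvadj _ (by omega)]; omega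
    · rw [SimpleGraph.adj_comm, hvadj _ (by omega)]; omega
    · rw [hpadj _ (by omega) _ (by omega)]; omega
  exact hG (p.length + 2) (by omega) (hasInducedCycleLen_iff.2 ⟨⟨⟨g, hinj⟩, hgadj _ _⟩⟩)

theorem Chordal.exists_simplicialIn_not_adj [DecidableEq V] {G : SimpleGraph V} (hG : Chordal G)
    (W : Finset V) : ∀ v ∈ W, (∃ u ∈ W, u ≠ v ∧ ¬ G.Adj v u) →
      ∃ w, SimplicialIn G W w ∧ w ≠ v ∧ ¬ G.Adj v w := by
  classical
  induction W using Finset.strongInduction with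
  | H W ih =>
    rintro v hv ⟨u, hu, huv, hvu⟩
    let U : Set V := {x | x ∈ W ∧ x ≠ v ∧ ¬ G.Adj v x}
    let C := W.filter fun x => (x ≠ v ∧ ¬ G.Adj v x) ∧ (edgesWithin G U).Reachable u x
    let S := W.filter fun s => G.Adj v s ∧ ∃ c ∈ C, G.Adj s c
    have hC : ∀ {x}, x ∈ C ↔
        x ∈ W ∧ (x ≠ v ∧ ¬ G.Adj v x) ∧ (edgesWithin G U).Reachable u x := Finset.mem_filter
    have hS : ∀ {x}, x ∈ S ↔ x ∈ W ∧ G.Adj v x ∧ ∃ c ∈ C, G.Adj x c := Finset.mem_filter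
    have huC : u ∈ C := hC.2 ⟨hu, ⟨huv, hvu⟩, SimpleGraph.Reachable.refl _⟩
    have hclique : ∀ s ∈ S, ∀ t ∈ S, s ≠ t → G.Adj s t := by
      intro s hs t ht hst
      obtain ⟨-, hvs, c, hc, hsc⟩ := hS.1 hs
      obtain ⟨-, hvt, d, hd, htd⟩ := hS.1 ht
      obtain ⟨-, hcv, hcr⟩ := hC.1 hc
      obtain ⟨-, hdv, hdr⟩ := hC.1 hd
      refine hG.adj_of_reachable hvs hvt hst ?_
      have h₁ : (edgesWithin G ({x | x ≠ v ∧ ¬ G.Adj v x} ∪ {s, t})).Adj s c :=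
        ⟨hsc, by simp, Or.inl hcv⟩
      have h₂ : (edgesWithin G ({x | x ≠ v ∧ ¬ G.Adj v x} ∪ {s, t})).Adj t d :=
        ⟨htd, by simp, Or.inl hdv⟩
      refine (h₁.reachable.trans ?_).trans h₂.reachable.symm
      exact (hcr.symm.trans hdr).mono (edgesWithin_mono G fun x hx => Or.inl hx.2)
    have hclosed : ∀ w ∈ C, ∀ x ∈ W, G.Adj w x → x ∈ C ∪ S := by
      intro w hw x hx hwx
      obtain ⟨hwW, hwv, hwr⟩ := hC.1 hw
      have hxv : x ≠ v := fun e => hwv.2 (e ▸ hwx.symm)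
      rw [Finset.mem_union]
      by_cases h : G.Adj v x
      · exact Or.inr (hS.2 ⟨hx, h, w, hw, hwx.symm⟩)
      · refine Or.inl (hC.2 ⟨hx, ⟨hxv, h⟩, hwr.trans (SimpleGraph.Adj.reachable ?_)⟩)
        exact ⟨hwx, ⟨hwW, hwv⟩, hx, hxv, h⟩
    have hss : C ∪ S ⊂ W := by
      refine (Finset.ssubset_iff_of_subset ?_).2 ⟨v, hv, ?_⟩
      · exact Finset.union_subset (Finset.filter_subset _ _) (Finset.filter_subset _ _)
      · rw [Finset.mem_union, hC, hS]
        rintro (h | h)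
        · exact h.2.1.1 rfl
        · exact G.irrefl h.2.1
    obtain ⟨w, hw, hwC⟩ : ∃ w, SimplicialIn G (C ∪ S) w ∧ w ∈ C := by
      by_cases h₁ : ∃ s ∈ S, ∃ y ∈ C ∪ S, y ≠ s ∧ ¬ G.Adj s y
      · obtain ⟨s, hs, hy⟩ := h₁
        obtain ⟨w, hw, hws, hsw⟩ := ih _ hss s (Finset.mem_union_right _ hs) hy
        refine ⟨w, hw, (Finset.mem_union.1 hw.1).resolve_right fun h => ?_⟩
        exact hsw (hclique s hs w h hws.symm)
      · push Not at h₁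
        by_cases h₂ : ∃ c ∈ C, ∃ y ∈ C ∪ S, y ≠ c ∧ ¬ G.Adj c y
        · obtain ⟨c, hc, hy⟩ := h₂
          obtain ⟨w, hw, hwc, hcw⟩ := ih _ hss c (Finset.mem_union_left _ hc) hy
          refine ⟨w, hw, (Finset.mem_union.1 hw.1).resolve_right fun h => ?_⟩
          exact hcw (h₁ w h c (Finset.mem_union_left _ hc) hwc.symm).symm
        · push Not at h₂
          refine ⟨u, ⟨Finset.mem_union_left _ huC, fun x hx y hy _ _ hxy => ?_⟩, huC⟩
          rcases Finset.mem_union.1 hx with h | h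
          · exact h₂ x h y hy hxy.symm
          · exact h₁ x h y hy hxy.symm
    obtain ⟨hwW, hwv, -⟩ := hC.1 hwC
    refine ⟨w, ⟨hwW, fun x hx y hy hwx hwy hxy => ?_⟩, hwv⟩
    exact hw.2 x (hclosed w hwC x hx hwx) y (hclosed w hwC y hy hwy) hwx hwy hxy

/-- Dirac's theorem: a chordal graph has a simplicial vertex. -/
theorem Chordal.exists_simplicialIn [DecidableEq V] {G : SimpleGraph V} (hG : Chordal G)
    (W : Finset V) (hW : W.Nonempty) : ∃ v, SimplicialIn G W v := by
  by_cases h : ∃ v ∈ W, ∃ u ∈ W, u ≠ v ∧ ¬ G.Adj v u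
  · obtain ⟨v, hv, hu⟩ := h
    obtain ⟨w, hw, -⟩ := hG.exists_simplicialIn_not_adj W v hv hu
    exact ⟨w, hw⟩
  · push Not at h
    obtain ⟨v, hv⟩ := hW
    exact ⟨v, hv, fun x hx y hy _ _ hxy => h x hx y hy hxy.symm⟩

end Graph

section NotFree
variable {V : Type} [DecidableEq V]

theorem koszul_exact_of_free {M : Type*} [AddCommGroup M] [Module (MvPolynomial V ℚ) M]
    [Module.Free (MvPolynomial V ℚ) M] [Module.Finite (MvPolynomial V ℚ) M]
    {u v w z : V} (huv : u ≠ v) (hvw : v ≠ w) (huw : u ≠ w) (huz : u ≠ z)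
    (hvz : v ≠ z) (hwz : w ≠ z) {p q r : M}
    (h : (X u - X v : MvPolynomial V ℚ) • p + (X v - X w : MvPolynomial V ℚ) • q +
      (X w - X z : MvPolynomial V ℚ) • r = 0) :
    ∃ a b : M,
      r = (X u - X v : MvPolynomial V ℚ) • b - (X v - X w : MvPolynomial V ℚ) • a := by
  let B := (Module.Free.chooseBasis (MvPolynomial V ℚ) M).equivFun
  have hi : ∀ i, ∃ a b : MvPolynomial V ℚ, B r i = (X u - X v) * b - (X v - X w) * a := by
    intro i
    refine koszul_exact huv hvw huw huz hvz hwz (p := B p i) (q := B q i) ?_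
    simpa using congrFun (congrArg B h) i
  choose a b hab using hi
  refine ⟨B.symm a, B.symm b, B.injective ?_⟩
  funext i
  simp [hab]

/-- A criterion for membership of functions supported on two vertices. -/
theorem mem_splines_of_support_pair [Fintype V] {G : SimpleGraph V} {v w : V}
    {g : V → MvPolynomial V ℚ} (h₀ : ∀ i, i ≠ v → i ≠ w → g i = 0)
    (h₁ : ∀ j, G.Adj v j → j ≠ w → X v - X j ∣ g v)
    (h₂ : ∀ j, G.Adj w j → j ≠ v → X w - X j ∣ g w) (h₃ : X v - X w ∣ g v - g w) :
    g ∈ splines G Finset.univ := by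
  have one : ∀ i j, G.Adj i j → (i = v ∨ i = w) → X i - X j ∣ g i - g j := by
    rintro i j h (rfl | rfl)
    · by_cases hj : j = w
      · rwa [hj]
      · rw [h₀ j h.ne' hj, sub_zero]
        exact h₁ j h hj
    · by_cases hj : j = v
      · rw [hj, ← neg_sub, neg_dvd, ← dvd_neg, neg_sub]
        exact h₃
      · rw [h₀ j hj h.ne', sub_zero]
        exact h₂ j h hj
  refine ⟨fun i hi => absurd (Finset.mem_univ i) hi, fun i _ j _ h => ?_⟩
  by_cases hi : i = v ∨ i = w
  · exact one i j h hi
  · by_cases hj : j = v ∨ j = w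
    · rw [← neg_sub, neg_dvd, ← dvd_neg, neg_sub]
      exact one j i h.symm hj
    · push Not at hi hj
      rw [h₀ i hi.1 hi.2, h₀ j hj.1 hj.2, sub_zero]
      exact dvd_zero _

/-- If the splines form a free module, exactness of the Koszul complex yields a function that is
a spline up to a defect `s` along the edge `v w`. -/
theorem exists_spline_with_defect [Fintype V] {G : SimpleGraph V}
    [Module.Free (MvPolynomial V ℚ) (splines G Finset.univ)]
    {u v w z : V} (huv : u ≠ v) (hvw : v ≠ w) (huw : u ≠ w) (huz : u ≠ z)
    (hvz : v ≠ z) (hwz : w ≠ z) (hvw_adj : G.Adj v w) {s : MvPolynomial V ℚ}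
    (hvd : ∀ j, G.Adj v j → j ≠ w → X v - X j ∣ s * (X u - X v))
    (hwd : ∀ j, G.Adj w j → j ≠ v → X w - X j ∣ s * (X w - X z)) :
    ∃ h : V → MvPolynomial V ℚ, X v - X w ∣ h v - s - h w ∧
      ∀ i j, G.Adj i j → ¬ (i = v ∧ j = w) → ¬ (i = w ∧ j = v) → X i - X j ∣ h i - h j := by
  set a : MvPolynomial V ℚ := X u - X v with ha
  set b : MvPolynomial V ℚ := X v - X w with hb
  set c : MvPolynomial V ℚ := X w - X z with hc
  let p : splines G Finset.univ := ⟨Pi.single w (s * b * c), mem_splines_of_support_pair (v := v) (w := w)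
    (fun i _ hi => Pi.single_eq_of_ne hi _)
    (fun j _ _ => by rw [Pi.single_eq_of_ne hvw]; exact dvd_zero _)
    (fun j h hj => by
      rw [Pi.single_eq_same, mul_right_comm]; exact (hwd j h hj).mul_right _)
    (by rw [Pi.single_eq_of_ne hvw, Pi.single_eq_same, zero_sub, dvd_neg, mul_assoc, mul_left_comm]
        exact dvd_mul_right _ _)⟩
  let q : splines G Finset.univ :=
    ⟨Pi.single v (-(s * a * c)) + Pi.single w (-(s * a * c)), mem_splines_of_support_pair (v := v) (w := w)
    (fun i hi hi' => by simp [hi, hi'])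
    (fun j h hj => by
      simpa [hvw] using (hvd j h hj).mul_right c)
    (fun j h hj => by
      simpa [hvw, mul_right_comm] using (hwd j h hj).mul_right a)
    (by simp [hvw, hvw.symm])⟩
  let r : splines G Finset.univ := ⟨Pi.single v (s * a * b), mem_splines_of_support_pair (v := v) (w := w)
    (fun i hi _ => Pi.single_eq_of_ne hi _)
    (fun j h hj => by
      rw [Pi.single_eq_same]; exact (hvd j h hj).mul_right _)
    (fun j _ _ => by rw [Pi.single_eq_of_ne hvw.symm]; exact dvd_zero _)
    (by rw [Pi.single_eq_of_ne hvw.symm, Pi.single_eq_same, sub_zero]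
        exact dvd_mul_left _ _)⟩
  have hrel : a • p + b • q + c • r = 0 := by
    ext1; funext i
    simp only [p, q, r, Submodule.coe_add, Submodule.coe_smul, Pi.add_apply, Pi.smul_apply,
      smul_eq_mul, Pi.single_apply, ZeroMemClass.coe_zero, Pi.zero_apply]
    split_ifs <;> ring
  obtain ⟨x, y, hr⟩ := koszul_exact_of_free huv hvw huw huz hvz hwz hrel
  have hb0 : b ≠ 0 := X_sub_X_ne_zero hvw
  have hab : ¬ b ∣ a := X_sub_X_not_dvd huv (fun e => huv e.1) (fun e => huw e.1)
  have hr' : ∀ i, (Pi.single v (s * a * b) : V → MvPolynomial V ℚ) i = a * y.1 i - b * x.1 i := fun i =>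
    congrFun (congrArg Subtype.val hr) i
  have hy : ∀ i, b ∣ y.1 i := by
    intro i
    refine ((prime_X_sub_X hvw).dvd_or_dvd (?_ : b ∣ a * y.1 i)).resolve_left hab
    have : a * y.1 i = (Pi.single v (s * a * b) : V → MvPolynomial V ℚ) i + b * x.1 i := by rw [hr']; ring
    rw [this, Pi.single_apply]
    refine dvd_add ?_ (dvd_mul_right _ _)
    split_ifs
    · exact dvd_mul_left _ _
    · exact dvd_zero _
  choose h hh using hy
  have hx : ∀ i, x.1 i = a * h i - (Pi.single v (s * a) : V → MvPolynomial V ℚ) i := by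
    intro i
    apply mul_left_cancel₀ hb0
    have := hr' i
    rw [hh, Pi.single_apply] at this
    rw [Pi.single_apply]
    split_ifs at this ⊢ <;> linear_combination this
  refine ⟨h, ?_, fun i j hij h₁ h₂ => ?_⟩
  · have := x.2.2 v (Finset.mem_univ _) w (Finset.mem_univ _) hvw_adj
    rw [hx, hx, Pi.single_eq_same, Pi.single_eq_of_ne hvw.symm] at this
    have h' : b ∣ a * (h v - s - h w) := by
      convert this using 1; ring
    exact ((prime_X_sub_X hvw).dvd_or_dvd h').resolve_left hab
  · have := y.2.2 i (Finset.mem_univ _) j (Finset.mem_univ _) hij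
    rw [hh, hh, ← mul_sub] at this
    refine ((prime_X_sub_X hij.ne).dvd_or_dvd this).resolve_left
      (X_sub_X_not_dvd hvw (fun e => h₁ ⟨e.1.symm, e.2.symm⟩) (fun e => h₂ ⟨e.2.symm, e.1.symm⟩))

/-- A graph whose splines form a free module has no induced cycle of length at least four; here
the cycle is given by the enumeration `c` of its vertices. -/
theorem not_free_splines_of_cycle [Fintype V] (G : SimpleGraph V) {n : ℕ} (hn : 4 ≤ n) (c : ℕ → V)
    (hc : ∀ i < n, ∀ j < n, c i = c j → i = j)
    (hadj : ∀ i < n, ∀ j < n, (G.Adj (c i) (c j) ↔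
      i + 1 = j ∨ j + 1 = i ∨ (i = 0 ∧ j + 1 = n) ∨ (j = 0 ∧ i + 1 = n))) :
    ¬ Module.Free (MvPolynomial V ℚ) (splines G Finset.univ) := by
  intro hfree
  have hne : ∀ i j, i < n → j < n → i ≠ j → c i ≠ c j := fun i j hi hj h e => h (hc i hi j hj e)
  let R : Set V := {x | ∃ i < n, c i = x}
  have hR : ∀ i < n, c i ∈ R := fun i hi => ⟨i, hi, rfl⟩
  obtain ⟨s, hs₀, hs⟩ := exists_dvd_killVars_ne_zero G R
  have hvd : ∀ j, G.Adj (c 1) j → j ≠ c 2 → X (c 1) - X j ∣ s * (X (c 0) - X (c 1)) := by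
    intro j h hj
    by_cases hr : j ∈ R
    · obtain ⟨k, hk, rfl⟩ := hr
      rw [hadj 1 (by omega) k hk] at h
      have hk2 : k ≠ 2 := fun e => hj (e ▸ rfl)
      obtain rfl : k = 0 := by omega
      rw [← neg_sub, neg_dvd]
      exact dvd_mul_left _ _
    · exact (hs _ j h fun h' => hr h'.2).mul_right _
  have hwd : ∀ j, G.Adj (c 2) j → j ≠ c 1 → X (c 2) - X j ∣ s * (X (c 2) - X (c 3)) := by
    intro j h hj
    by_cases hr : j ∈ R
    · obtain ⟨k, hk, rfl⟩ := hr
      rw [hadj 2 (by omega) k hk] at h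
      have hk1 : k ≠ 1 := fun e => hj (e ▸ rfl)
      obtain rfl : k = 3 := by omega
      exact dvd_mul_left _ _
    · exact (hs _ j h fun h' => hr h'.2).mul_right _
  obtain ⟨h, hdef, hstep⟩ := exists_spline_with_defect
    (hne 0 1 (by omega) (by omega) (by omega)) (hne 1 2 (by omega) (by omega) (by omega))
    (hne 0 2 (by omega) (by omega) (by omega)) (hne 0 3 (by omega) (by omega) (by omega))
    (hne 1 3 (by omega) (by omega) (by omega)) (hne 2 3 (by omega) (by omega) (by omega))
    ((hadj 1 (by omega) 2 (by omega)).2 (by omega)) hvd hwd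
  have hdefect := killVars_of_dvd (hR 1 (by omega)) (hR 2 (by omega)) hdef
  rw [map_sub, map_sub] at hdefect
  have hedge : ∀ i < n, ∀ j < n, G.Adj (c i) (c j) → ¬ (i = 1 ∧ j = 2) → ¬ (i = 2 ∧ j = 1) →
      killVars R (h (c i)) = killVars R (h (c j)) := by
    intro i hi j hj hij h₁ h₂
    rw [← sub_eq_zero, ← map_sub]
    refine killVars_of_dvd (hR i hi) (hR j hj) (hstep _ _ hij ?_ ?_)
    · exact fun e => h₁ ⟨hc i hi 1 (by omega) e.1, hc j hj 2 (by omega) e.2⟩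
    · exact fun e => h₂ ⟨hc i hi 2 (by omega) e.1, hc j hj 1 (by omega) e.2⟩
  have hpath : ∀ k, k + 2 < n → killVars R (h (c (k + 2))) = killVars R (h (c 2)) := by
    intro k
    induction k with
    | zero => intro _; rfl
    | succ k ih =>
      intro hk
      rw [← ih (by omega)]
      exact hedge _ hk _ (by omega) ((hadj _ hk _ (by omega)).2 (by omega)) (by omega) (by omega)
  have hlast := hpath (n - 3) (by omega)
  have hclose := hedge 0 (by omega) (n - 3 + 2) (by omega)
    ((hadj _ (by omega) _ (by omega)).2 (by omega)) (by omega) (by omega)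
  have hfirst := hedge 0 (by omega) 1 (by omega)
    ((hadj _ (by omega) _ (by omega)).2 (by omega)) (by omega) (by omega)
  exact hs₀ (by linear_combination -hdefect - hfirst + hclose + hlast)

end NotFree

/-- Evaluation at the variables identifies logarithmic derivations with splines. -/
noncomputable def logDerEquivSplines (ℓ : ℕ) (G : SimpleGraph (Fin ℓ)) :
    logDer ℓ G ≃ₗ[Spoly ℓ] splines G Finset.univ where
  toFun θ := ⟨fun i => θ.1 (X i), fun i hi => absurd (Finset.mem_univ i) hi,
    fun i _ j _ h => θ.2 i j h⟩
  map_add' _ _ := rfl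
  map_smul' _ _ := rfl
  invFun g := ⟨mkDerivation ℚ g.1, fun i j h => by
    rw [mkDerivation_X, mkDerivation_X]
    exact g.2.2 i (Finset.mem_univ _) j (Finset.mem_univ _) h⟩
  left_inv θ := Subtype.ext (derivation_ext fun i => mkDerivation_X _ _ _)
  right_inv g := Subtype.ext (funext fun i => mkDerivation_X _ _ _)

/-- `D(A(G))` is a free `S`-module if and only if `G` is chordal. -/
theorem free_iff_chordal (ℓ : ℕ) (hℓ : 1 ≤ ℓ) (G : SimpleGraph (Fin ℓ)) :
    Module.Free (Spoly ℓ) (logDer ℓ G) ↔ Chordal G := by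
  constructor
  · intro hfree n hn hcyc
    have hspl : Module.Free (Spoly ℓ) (splines G Finset.univ) :=
      Module.Free.of_equiv (logDerEquivSplines ℓ G)
    obtain ⟨f⟩ := hasInducedCycleLen_iff.1 hcyc
    have : NeZero n := ⟨by omega⟩
    have hval : ∀ i < n, (Fin.ofNat n i).val = i := fun i hi => Nat.mod_eq_of_lt hi
    refine not_free_splines_of_cycle G hn (fun i => f (Fin.ofNat n i)) (fun i hi j hj e => ?_)
      (fun i hi j hj => ?_) hspl
    · rw [← hval i hi, f.injective e, hval j hj]
    · rw [f.map_adj_iff, cycleGraph_adj_iff_val, Ne, Fin.ext_iff, hval i hi, hval j hj]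
      omega
  · intro hG
    have := free_splines G hG.exists_simplicialIn Finset.univ
    exact Module.Free.of_equiv (logDerEquivSplines ℓ G).symm
end

section
/- Let G be a finite simple graph on {1,…,ℓ} and let G' be an induced subgraph of G on a subset of the vertices. Then the projective dimension of D(A(G')) (as a module over the polynomial ring in the corresponding variables, or equivalently of the graphic arrangement of G' regarded on the full vertex set {1,…,ℓ} over S) is at most the projective dimension of D(A(G)). -/
open MvPolynomial CategoryTheory

namespace CategoryTheory

open Limits Abelian

variable {C : Type*} [Category* C] [Abelian C]

/-- An object with a projective resolution vanishing above degree `n` has projective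
dimension at most `n`. -/
lemma ProjectiveResolution.hasProjectiveDimensionLE {M : C} (P : ProjectiveResolution M) {n : ℕ}
    (hP : ∀ i, n < i → IsZero (P.complex.X i)) : HasProjectiveDimensionLE M n := by
  let := HasExt.standard C
  refine .mk fun i hi Y e ↦ ?_
  obtain ⟨f, hf, rfl⟩ := P.extMk_surjective e (i + 1) rfl
  obtain rfl : f = 0 := (hP i hi).eq_of_src _ _
  exact P.extMk_zero _ _

/-- The augmentation `P₀ ⟶ M` of a projective resolution of `M`. -/
noncomputable def ProjectiveResolution.augmentation {M : C} (P : ProjectiveResolution M) :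
    P.complex.X 0 ⟶ M :=
  P.π.f 0

instance {M : C} (P : ProjectiveResolution M) : Epi P.augmentation :=
  inferInstanceAs (Epi (P.π.f 0))

@[simp]
lemma ProjectiveResolution.d_augmentation {M : C} (P : ProjectiveResolution M) :
    P.complex.d 1 0 ≫ P.augmentation = 0 :=
  P.complex_d_comp_π_f_zero

lemma ProjectiveResolution.exact_augmentation {M : C} (P : ProjectiveResolution M) :
    (ShortComplex.mk _ _ P.d_augmentation).Exact :=
  P.exact₀

/-- Splicing a projective resolution of the kernel of `P ↠ M` with the projective object `P`. -/
noncomputable def ProjectiveResolution.splice {S : ShortComplex C} (hS : S.ShortExact)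
    [Projective S.X₂] (R : ProjectiveResolution S.X₁) : ProjectiveResolution S.X₃ where
  complex := R.complex.augment (R.augmentation ≫ S.f)
    (by rw [← Category.assoc, R.d_augmentation, zero_comp])
  projective n := by
    cases n with
    | zero => exact inferInstanceAs (Projective S.X₂)
    | succ n => exact R.projective n
  π := (ChainComplex.toSingle₀Equiv _ _).symm ⟨S.g, by
    change (R.augmentation ≫ S.f) ≫ S.g = 0
    rw [Category.assoc, S.zero, comp_zero]⟩
  quasiIso := ⟨fun n ↦ by
    have := hS.mono_f
    have := hS.epi_g
    have hw : (R.augmentation ≫ S.f) ≫ S.g = 0 := by rw [Category.assoc, S.zero, comp_zero]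
    have hw' : R.complex.d 1 0 ≫ R.augmentation ≫ S.f = 0 := by
      rw [← Category.assoc, R.d_augmentation, zero_comp]
    have hexact : (ShortComplex.mk _ _ hw).Exact := by
      let φ : ShortComplex.mk _ _ hw ⟶ S :=
        { τ₁ := R.augmentation, τ₂ := 𝟙 _, τ₃ := 𝟙 _ }
      have : Epi φ.τ₁ := inferInstanceAs (Epi R.augmentation)
      have : IsIso φ.τ₂ := inferInstanceAs (IsIso (𝟙 _))
      have : Mono φ.τ₃ := inferInstanceAs (Mono (𝟙 _))
      exact (ShortComplex.exact_iff_of_epi_of_isIso_of_mono φ).2 hS.exact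
    cases n with
    | zero =>
      rw [ChainComplex.quasiIsoAt₀_iff, ShortComplex.quasiIso_iff_of_zeros']
      · refine (ShortComplex.exact_and_epi_g_iff_of_iso ?_).2 ⟨hexact, hS.epi_g⟩
        exact ShortComplex.isoMk (Iso.refl _) (Iso.refl _) (Iso.refl _)
          ((Category.id_comp _).trans (Category.comp_id _).symm)
          ((Category.id_comp S.g).trans ((ChainComplex.toSingle₀Equiv_symm_apply_f_zero
            (C := R.complex.augment (R.augmentation ≫ S.f) hw') S.g hw).symm.trans
            (Category.comp_id _).symm))
      all_goals rfl
    | succ n =>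
      rw [quasiIsoAt_iff_exactAt' _ _ (ChainComplex.exactAt_succ_single_obj _ _),
        HomologicalComplex.exactAt_iff' _ (n + 2) (n + 1) n (by simp) (by simp)]
      cases n with
      | zero =>
        let φ : ShortComplex.mk _ _ R.d_augmentation ⟶ ShortComplex.mk _ _ hw' :=
          { τ₁ := 𝟙 _, τ₂ := 𝟙 _, τ₃ := S.f }
        have : Epi φ.τ₁ := inferInstanceAs (Epi (𝟙 _))
        have : IsIso φ.τ₂ := inferInstanceAs (IsIso (𝟙 _))
        have : Mono φ.τ₃ := inferInstanceAs (Mono S.f)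
        exact (ShortComplex.exact_iff_of_epi_of_isIso_of_mono φ).1 R.exact_augmentation
      | succ n => exact R.exact_succ n⟩

/-- An object of projective dimension at most `n` has a projective resolution vanishing
above degree `n`. -/
lemma exists_projectiveResolution_of_hasProjectiveDimensionLE [EnoughProjectives C] (n : ℕ) :
    ∀ (M : C) [HasProjectiveDimensionLE M n],
      ∃ P : ProjectiveResolution M, ∀ i, n < i → IsZero (P.complex.X i) := by
  induction n with
  | zero =>
    intro M _
    have := (projective_iff_hasProjectiveDimensionLE_zero M).2 inferInstance
    exact ⟨.self M, fun i hi ↦ HomologicalComplex.isZero_single_obj_X _ _ _ _ hi.ne'⟩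
  | succ n ih =>
    intro M _
    let S : ShortComplex C := .mk (kernel.ι (Projective.π M)) (Projective.π M) (by simp)
    have hS : S.ShortExact := { exact := ShortComplex.exact_kernel _ }
    have hp : Projective S.X₂ := inferInstanceAs (Projective (Projective.over M))
    have : HasProjectiveDimensionLE S.X₁ n :=
      (hS.hasProjectiveDimensionLT_X₃_iff n hp).1 ‹_›
    obtain ⟨R, hR⟩ := ih S.X₁
    refine ⟨R.splice hS, fun i hi ↦ ?_⟩
    obtain ⟨i, rfl⟩ := Nat.exists_eq_add_of_lt hi
    exact hR _ (by lia)

/-- A scalar whose action on `M` factors through an object of projective dimension `< n`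
annihilates `Ext M Y i` for `n ≤ i`. -/
lemma smul_ext_eq_zero_of_factors {R : Type*} [CommRing R] [Linear R C] [HasExt C] {M N Y : C}
    {n i : ℕ} [HasProjectiveDimensionLT N n] (hi : n ≤ i) {r : R} (f : M ⟶ N) (g : N ⟶ M)
    (h : f ≫ g = r • 𝟙 M) (e : Ext M Y i) : r • e = 0 := by
  calc
    r • e = (Ext.mk₀ (f ≫ g)).comp e (zero_add i) := by
      rw [h, Ext.mk₀_smul, Ext.smul_comp, Ext.mk₀_id_comp]
    _ = (Ext.mk₀ f).comp ((Ext.mk₀ g).comp e (zero_add i)) (zero_add i) := by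
      rw [Ext.mk₀_comp_mk₀_assoc]
    _ = 0 := by
      rw [((Ext.mk₀ g).comp e (zero_add i)).eq_zero_of_hasProjectiveDimensionLT n hi,
        Ext.comp_zero]

end CategoryTheory

lemma pdLE_iff_hasProjectiveDimensionLE {R : Type} [CommRing R] (M : ModuleCat.{0} R) (n : ℕ) :
    pdLE M n ↔ HasProjectiveDimensionLE M n :=
  ⟨fun ⟨P, hP⟩ ↦ P.hasProjectiveDimensionLE hP,
    fun _ ↦ exists_projectiveResolution_of_hasProjectiveDimensionLE n M⟩

variable {ℓ : ℕ}

/-- The translation `x_i ↦ x_i + a_i` of the polynomial ring. -/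
noncomputable def translation (a : Fin ℓ → ℚ) : Spoly ℓ ≃ₐ[ℚ] Spoly ℓ :=
  AlgEquiv.ofAlgHom (aeval fun i ↦ X i + C (a i)) (aeval fun i ↦ X i - C (a i))
    (by ext i; simp) (by ext i; simp)

@[simp]
lemma translation_X (a : Fin ℓ → ℚ) (i : Fin ℓ) : translation a (X i) = X i + C (a i) := by
  simp [translation]

@[simp]
lemma translation_symm_X (a : Fin ℓ → ℚ) (i : Fin ℓ) :
    (translation a).symm (X i) = X i - C (a i) := by
  simp [translation]

attribute [local instance] RingHomInvPair.of_ringEquiv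

/-- The semilinear action of an automorphism of the polynomial ring on derivations,
through the values at the variables. -/
noncomputable def derivationCongr (σ : Spoly ℓ ≃+* Spoly ℓ) :
    Derivation ℚ (Spoly ℓ) (Spoly ℓ) ≃ₛₗ[RingHomClass.toRingHom σ]
      Derivation ℚ (Spoly ℓ) (Spoly ℓ) where
  toFun θ := mkDerivation ℚ fun i ↦ σ (θ (X i))
  invFun θ := mkDerivation ℚ fun i ↦ σ.symm (θ (X i))
  map_add' θ η := by apply derivation_ext; intro i; simp [mkDerivation_X]
  map_smul' r θ := by apply derivation_ext; intro i; simp [mkDerivation_X]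
  left_inv θ := by apply derivation_ext; intro i; simp [mkDerivation_X]
  right_inv θ := by apply derivation_ext; intro i; simp [mkDerivation_X]

@[simp]
lemma derivationCongr_apply_X (σ : Spoly ℓ ≃+* Spoly ℓ)
    (θ : Derivation ℚ (Spoly ℓ) (Spoly ℓ)) (i : Fin ℓ) :
    (derivationCongr σ).toLinearMap θ (X i) = σ (θ (X i)) :=
  mkDerivation_X _ _ _

/-- Let `H ≤ G`, let the translation by `a` preserve the hyperplanes of `H`, and let `f` be
divisible by the equations of the other hyperplanes of `G`. If `D(A(G))` has projective
dimension `< n`, then the translate of `f` annihilates `Ext D(A(H)) Y i` for `n ≤ i`. -/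
lemma translation_smul_ext_logDer_eq_zero [HasExt (ModuleCat.{0} (Spoly ℓ))]
    {G H : SimpleGraph (Fin ℓ)} (hHG : H ≤ G) {a : Fin ℓ → ℚ}
    (ha : ∀ i j, H.Adj i j → a i = a j) {f : Spoly ℓ}
    (hf : ∀ i j, G.Adj i j → ¬ H.Adj i j → X i - X j ∣ f) {n k : ℕ}
    [HasProjectiveDimensionLE (ModuleCat.of (Spoly ℓ) (logDer ℓ G)) n] (hk : n + 1 ≤ k)
    {Y : ModuleCat.{0} (Spoly ℓ)}
    (e : Abelian.Ext (ModuleCat.of (Spoly ℓ) (logDer ℓ H)) Y k) :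
    translation a f • e = 0 := by
  let σ : Spoly ℓ ≃+* Spoly ℓ := (translation a).toRingEquiv
  let D : Submodule (Spoly ℓ) (Derivation ℚ (Spoly ℓ) (Spoly ℓ)) :=
    (logDer ℓ G).map (derivationCongr σ).toLinearMap
  have hD : D ≤ logDer ℓ H := by
    rintro _ ⟨θ, hθ, rfl⟩ i j hij
    rw [derivationCongr_apply_X, derivationCongr_apply_X]
    simpa [σ, ha i j hij] using map_dvd σ (hθ i j (hHG hij))
  have hfD : ∀ η ∈ logDer ℓ H, translation a f • η ∈ D := by
    intro η hη
    refine ⟨f • (derivationCongr σ.symm).toLinearMap η, fun i j hij ↦ ?_, ?_⟩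
    · rw [Derivation.smul_apply, Derivation.smul_apply, derivationCongr_apply_X,
        derivationCongr_apply_X, ← smul_sub, smul_eq_mul]
      by_cases h : H.Adj i j
      · have hσ : X i - X j ∣ σ.symm (η (X i)) - σ.symm (η (X j)) := by
          simpa [σ, ha i j h] using map_dvd σ.symm (hη i j h)
        exact hσ.mul_left f
      · exact (hf i j hij h).mul_right _
    · apply derivation_ext
      intro i
      rw [derivationCongr_apply_X, Derivation.smul_apply, derivationCongr_apply_X]
      simp [σ]
  have : HasProjectiveDimensionLE (ModuleCat.of (Spoly ℓ) D) n :=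
    ModuleCat.hasProjectiveDimensionLE_of_semiLinearEquiv
      (M := ModuleCat.of (Spoly ℓ) (logDer ℓ G)) (N := ModuleCat.of (Spoly ℓ) D) σ
      ((derivationCongr σ).submoduleMap (logDer ℓ G)) n
  let p : logDer ℓ H →ₗ[Spoly ℓ] D :=
    LinearMap.codRestrict D
      (LinearMap.lsmul (Spoly ℓ) _ (translation a f) ∘ₗ (logDer ℓ H).subtype)
      fun η ↦ hfD η η.2
  exact smul_ext_eq_zero_of_factors (n := n + 1) hk (N := ModuleCat.of (Spoly ℓ) D)
    (ModuleCat.ofHom p) (ModuleCat.ofHom (Submodule.inclusion hD)) rfl e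

/-- If all translates of a product of linear forms `x_i - x_j` along a direction `v` on which
none of them vanishes lie in an ideal, then this ideal is the unit ideal. -/
lemma eq_top_of_forall_translation_prod_mem (s : Finset (Fin ℓ × Fin ℓ)) {v : Fin ℓ → ℚ}
    (hv : ∀ p ∈ s, v p.1 ≠ v p.2) {I : Ideal (Spoly ℓ)}
    (hI : ∀ c : ℚ, translation (c • v) (∏ p ∈ s, (X p.1 - X p.2)) ∈ I) : I = ⊤ := by
  by_contra hne
  obtain ⟨m, hm, hIm⟩ := I.exists_le_maximal hne
  have hmem (c : ℚ) : ∃ p ∈ s, translation (c • v) (X p.1 - X p.2) ∈ m := by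
    have := hIm (hI c)
    rwa [map_prod, hm.isPrime.prod_mem_iff] at this
  choose p hps hpm using hmem
  obtain ⟨c, d, hcd, hp⟩ := Finite.exists_ne_map_eq_of_infinite p
  have hsub := m.sub_mem (hpm c) (hp ▸ hpm d)
  have heq : translation (c • v) (X (p c).1 - X (p c).2)
      - translation (d • v) (X (p c).1 - X (p c).2)
      = C ((c - d) * (v (p c).1 - v (p c).2)) := by
    simp only [map_sub, translation_X, Pi.smul_apply, smul_eq_mul, map_mul]
    ring
  rw [heq] at hsub
  refine hm.ne_top (m.eq_top_of_isUnit_mem hsub (.map C (IsUnit.mk0 _ ?_)))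
  exact mul_ne_zero (sub_ne_zero.2 hcd) (sub_ne_zero.2 (hv _ (hps c)))

/-- The projective dimension of the graphic arrangement of an induced subgraph
(on the vertex subset `W`, regarded on the full vertex set) is at most that of
the graphic arrangement of `G`. -/
theorem pd_inducedSubgraph_le (ℓ : ℕ) (hℓ : 1 ≤ ℓ) (G : SimpleGraph (Fin ℓ))
    (W : Set (Fin ℓ)) :
    pd (ModuleCat.of (Spoly ℓ)
        (logDer ℓ (SimpleGraph.fromEdgeSet {e ∈ G.edgeSet | ∀ v ∈ e, v ∈ W}))) ≤
      pd (ModuleCat.of (Spoly ℓ) (logDer ℓ G)) := by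
  classical
  refine le_sInf ?_
  rintro _ ⟨n, rfl, hn⟩
  refine sInf_le ⟨n, rfl, ?_⟩
  rw [pdLE_iff_hasProjectiveDimensionLE] at hn ⊢
  set H := SimpleGraph.fromEdgeSet {e ∈ G.edgeSet | ∀ v ∈ e, v ∈ W} with hH
  have hadj (i j : Fin ℓ) : H.Adj i j ↔ G.Adj i j ∧ i ∈ W ∧ j ∈ W := by
    simp only [hH, SimpleGraph.fromEdgeSet_adj, Set.mem_ofPred_eq, SimpleGraph.mem_edgeSet,
      Sym2.ball]
    exact ⟨fun h ↦ h.1, fun h ↦ ⟨h, h.1.ne⟩⟩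
  let v (i : Fin ℓ) : ℚ := if i ∈ W then 0 else i + 1
  let s : Finset (Fin ℓ × Fin ℓ) := {p | G.Adj p.1 p.2 ∧ ¬ H.Adj p.1 p.2}
  have hv : ∀ p ∈ s, v p.1 ≠ v p.2 := by
    rintro ⟨i, j⟩ hp
    obtain ⟨hG, hW⟩ : G.Adj i j ∧ ¬ H.Adj i j := by simpa [s] using hp
    have hij : ((i : ℕ) : ℚ) ≠ (j : ℕ) := by exact_mod_cast Fin.val_ne_of_ne hG.ne
    have hi : ((i : ℕ) : ℚ) + 1 ≠ 0 := by positivity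
    have hj : ((j : ℕ) : ℚ) + 1 ≠ 0 := by positivity
    rw [hadj] at hW
    by_cases hiW : i ∈ W <;> by_cases hjW : j ∈ W <;> simp_all [v, eq_comm]
  have hdvd (i j : Fin ℓ) (hG : G.Adj i j) (h : ¬ H.Adj i j) :
      (X i - X j : Spoly ℓ) ∣ ∏ p ∈ s, (X p.1 - X p.2) := by
    have hs : (i, j) ∈ s := by simp [s, hG, h]
    exact (Finset.dvd_prod_of_mem (fun p : Fin ℓ × Fin ℓ ↦ (X p.1 - X p.2 : Spoly ℓ)) hs :)
  let := HasExt.standard (ModuleCat.{0} (Spoly ℓ))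
  refine .mk fun k hk Y e ↦ ?_
  have htop : Ideal.torsionOf (Spoly ℓ) _ e = ⊤ := by
    refine eq_top_of_forall_translation_prod_mem s hv fun c ↦ ?_
    rw [Ideal.mem_torsionOf_iff]
    refine translation_smul_ext_logDer_eq_zero (G := G) (n := n) (fun i j h ↦ ((hadj i j).1 h).1)
      (fun i j h ↦ ?_) (fun i j hG h ↦ ?_) hk e
    · obtain ⟨-, hi, hj⟩ := (hadj i j).1 h
      simp [v, hi, hj]
    · exact hdvd i j hG h
  exact (Ideal.torsionOf_eq_top_iff (R := Spoly ℓ) e).1 htop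
end

section
/- Let ℓ ≥ 3 and read indices in {1,…,ℓ} cyclically modulo ℓ. For every integer j ≥ 1, the following identity holds in ℚ[x_1,…,x_ℓ]: Σ_{i=1}^{ℓ} (x_i − x_{i+1}) · e_j(x_1,…,x̂_i,x̂_{i+1},…,x_ℓ) = 0, where e_j denotes the j-th elementary symmetric polynomial in the ℓ−2 variables listed (the variables x_i and x_{i+1} being omitted). -/
open MvPolynomial CategoryTheory

/-- The `n`-th elementary symmetric polynomial in the variables `x_v`, `v ∈ s`
(equal to `0` when `n > #s`). -/
noncomputable def esub (ℓ : ℕ) (s : Finset (Fin ℓ)) (n : ℕ) : Spoly ℓ :=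
  ∑ t ∈ s.powersetCard n, ∏ v ∈ t, X v

theorem esub_insert_succ {ℓ : ℕ} {a : Fin ℓ} {s : Finset (Fin ℓ)} (ha : a ∉ s) (n : ℕ) :
    esub ℓ (insert a s) (n + 1) = esub ℓ s (n + 1) + X a * esub ℓ s n := by
  have mem_of {t : Finset (Fin ℓ)} (ht : t ∈ s.powersetCard n) : a ∉ t :=
    fun h => ha ((Finset.mem_powersetCard.1 ht).1 h)
  unfold esub
  rw [Finset.powersetCard_succ_insert ha, Finset.sum_union, Finset.sum_image, Finset.mul_sum]
  · exact congrArg _ (Finset.sum_congr rfl fun t ht => Finset.prod_insert (mem_of ht))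
  · intro t ht u hu h
    rw [← Finset.erase_insert (mem_of ht), ← Finset.erase_insert (mem_of hu)]
    exact congrArg (fun v => v.erase a) h
  · refine Finset.disjoint_left.2 fun t ht h => ?_
    obtain ⟨u, -, rfl⟩ := Finset.mem_image.1 h
    exact ha ((Finset.mem_powersetCard.1 ht).1 (Finset.mem_insert_self a u))

theorem sub_mul_esub_sdiff_pair {ℓ : ℕ} {a b : Fin ℓ} (hab : a ≠ b) (n : ℕ) :
    (X a - X b) * esub ℓ (Finset.univ \ {a, b}) n =
      esub ℓ (Finset.univ \ {b}) (n + 1) - esub ℓ (Finset.univ \ {a}) (n + 1) := by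
  have ha : Finset.univ \ {b} = insert a (Finset.univ \ {a, b}) := by
    ext v; by_cases h : v = a <;> simp_all
  have hb : Finset.univ \ {a} = insert b (Finset.univ \ {a, b}) := by
    ext v; by_cases h : v = b <;> simp_all [Ne.symm]
  rw [ha, hb, esub_insert_succ (by simp), esub_insert_succ (by simp)]
  ring

/-- The cyclic elementary-symmetric-polynomial identity
`Σ_{i=1}^{ℓ} (x_i − x_{i+1}) e_j(x_1, …, x̂_i, x̂_{i+1}, …, x_ℓ) = 0` for `j ≥ 1`. -/
theorem cyclic_esymm_identity (ℓ : ℕ) [NeZero ℓ] (hℓ : 3 ≤ ℓ) (j : ℕ) (hj : 1 ≤ j) :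
    ∑ i : Fin ℓ, (X i - X (i + 1)) * esub ℓ (Finset.univ \ {i, i + 1}) j = 0 := by
  have hne (i : Fin ℓ) : i ≠ i + 1 := by
    intro h
    have h1 := congrArg Fin.val (left_eq_add.1 h)
    rw [Fin.val_one', Nat.mod_eq_of_lt (by omega)] at h1
    simp at h1
  rw [Finset.sum_congr rfl fun i _ => sub_mul_esub_sdiff_pair (hne i) j,
    Finset.sum_sub_distrib, sub_eq_zero]
  exact Equiv.sum_comp (Equiv.addRight (1 : Fin ℓ))
    fun i => esub ℓ (Finset.univ \ {i}) (j + 1)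
end
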